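/- arXiv:1301.5646 — 8 statements merged into one kernel-verified Lean document; each statement's English description precedes it below -/
import Mathlib

section
/- For every α with 0 < α < 1, the function s_α is Hölder continuous on [−1,1] with exponent α: there exists a constant C > 0 such that |s_α(x) − s_α(y)| ≤ C|x − y|^α for all x, y ∈ [−1,1]. -/
open Real

/-- Renyi-α covariance entropy function (von-Neumann entropy for `α = 1`). -/
noncomputable def sFun (α x : ℝ) : ℝ :=
  if α = 1 then
    -(((1 + x) / 2) * Real.logb 2 ((1 + x) / 2)) - ((1 - x) / 2) * Real.logb 2 ((1 - x) / 2)
  else (1 / (1 - α)) * Real.logb 2 (((1 + x) / 2) ^ α + ((1 - x) / 2) ^ α)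

theorem Real.abs_rpow_sub_rpow_le {p a b : ℝ} (ha : 0 ≤ a) (hb : 0 ≤ b) (hp : 0 ≤ p)
    (hp1 : p ≤ 1) : |a ^ p - b ^ p| ≤ |a - b| ^ p := by
  wlog hab : b ≤ a generalizing a b
  · rw [abs_sub_comm, abs_sub_comm a]
    exact this hb ha (le_of_not_ge hab)
  have h := Real.rpow_add_le_add_rpow (sub_nonneg.2 hab) hb hp hp1
  rw [sub_add_cancel] at h
  rw [abs_of_nonneg (sub_nonneg.2 (Real.rpow_le_rpow hb hab hp)),
    abs_of_nonneg (sub_nonneg.2 hab)]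
  linarith

theorem Real.abs_log_sub_log_le {u v : ℝ} (hu : 1 ≤ u) (hv : 1 ≤ v) :
    |log u - log v| ≤ |u - v| := by
  wlog huv : v ≤ u generalizing u v
  · rw [abs_sub_comm, abs_sub_comm u]
    exact this hv hu (le_of_not_ge huv)
  have hv0 : 0 < v := by linarith
  have hu0 : 0 < u := by linarith
  rw [abs_of_nonneg (sub_nonneg.2 (log_le_log hv0 huv)), abs_of_nonneg (sub_nonneg.2 huv),
    ← log_div hu0.ne' hv0.ne']
  calc log (u / v) ≤ u / v - 1 := log_le_sub_one_of_pos (by positivity)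
    _ = (u - v) / v := by field_simp
    _ ≤ u - v := div_le_self (sub_nonneg.2 huv) hv

theorem one_le_rpow_add_rpow_of_mem_Icc {α x : ℝ} (hα0 : 0 < α) (hα1 : α < 1)
    (hx : x ∈ Set.Icc (-1 : ℝ) 1) : 1 ≤ ((1 + x) / 2) ^ α + ((1 - x) / 2) ^ α := by
  obtain ⟨h1, h2⟩ := hx
  have h := Real.rpow_add_le_add_rpow (a := (1 + x) / 2) (b := (1 - x) / 2)
    (by linarith) (by linarith) hα0.le hα1.le
  rwa [show (1 + x) / 2 + (1 - x) / 2 = 1 by ring, Real.one_rpow] at h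

/-- **Hölder continuity of the Renyi entropy functions for `0 < α < 1`**:
`s_α` is Hölder continuous on `[-1,1]` with exponent `α`. -/
theorem sFun_holder_of_lt_one (α : ℝ) (hα0 : 0 < α) (hα1 : α < 1) :
    ∃ C > (0 : ℝ), ∀ x ∈ Set.Icc (-1 : ℝ) 1, ∀ y ∈ Set.Icc (-1 : ℝ) 1,
      |sFun α x - sFun α y| ≤ C * |x - y| ^ α := by
  have hlog : 0 < log 2 := log_pos one_lt_two
  have hα : 0 < 1 - α := sub_pos.2 hα1
  refine ⟨1 / (1 - α) * (2 / log 2), by positivity, fun x hx y hy => ?_⟩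
  have key : ∀ a b : ℝ, 0 ≤ a → 0 ≤ b → |a - b| ≤ |x - y| → |a ^ α - b ^ α| ≤ |x - y| ^ α :=
    fun a b ha hb h => (Real.abs_rpow_sub_rpow_le ha hb hα0.le hα1.le).trans
      (Real.rpow_le_rpow (abs_nonneg _) h hα0.le)
  have half : |x - y| / 2 ≤ |x - y| := half_le_self (abs_nonneg _)
  have h1 := key ((1 + x) / 2) ((1 + y) / 2) (by linarith [hx.1]) (by linarith [hy.1]) (by
    rwa [show (1 + x) / 2 - (1 + y) / 2 = (x - y) / 2 by ring, abs_div, abs_two])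
  have h2 := key ((1 - x) / 2) ((1 - y) / 2) (by linarith [hx.2]) (by linarith [hy.2]) (by
    rwa [show (1 - x) / 2 - (1 - y) / 2 = -((x - y) / 2) by ring, abs_neg, abs_div, abs_two])
  have hl := Real.abs_log_sub_log_le (one_le_rpow_add_rpow_of_mem_Icc hα0 hα1 hx)
    (one_le_rpow_add_rpow_of_mem_Icc hα0 hα1 hy)
  simp only [sFun, if_neg hα1.ne, Real.logb]
  rw [← mul_sub, ← sub_div, abs_mul, abs_of_pos (one_div_pos.2 hα), abs_div, abs_of_pos hlog,
    mul_assoc, div_mul_eq_mul_div 2]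
  gcongr
  refine hl.trans ?_
  rw [add_sub_add_comm]
  exact (abs_add_le _ _).trans (by linarith)
end

section
/- Let a < b be reals, let f ∈ L¹([a,b], ℂ), and let g : ℝ → ℂ be measurable, essentially bounded, and T-periodic for some T > 0 with ∫_0^T g(x) dx = 0. Then lim_{n→∞} ∫_a^b f(t) g(nt) dt = 0, where the limit is over n ∈ ℕ. -/
open Real Filter MeasureTheory

/-- Translation is continuous in `L¹(ℝ)`. -/
lemma tendsto_integral_norm_translate_sub {E : Type*} [NormedAddCommGroup E]
    {F : ℝ → E} (hF : Integrable F) :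
    Tendsto (fun s : ℝ => ∫ t, ‖F (s + t) - F t‖) (nhds 0) (nhds 0) := by
  have : Fact ((1 : ENNReal) ≠ ⊤) := ⟨ENNReal.one_ne_top⟩
  have hF' : MemLp F 1 volume := memLp_one_iff_integrable.2 hF
  have hcont : Continuous fun s : ℝ => ‖(DomAddAct.mk s +ᵥ hF'.toLp F) - hF'.toLp F‖ := by
    have : Continuous fun s : ℝ => DomAddAct.mk s := DomAddAct.continuous_mk
    fun_prop
  have key : ∀ s : ℝ, ‖(DomAddAct.mk s +ᵥ hF'.toLp F) - hF'.toLp F‖ =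
      ∫ t, ‖F (s + t) - F t‖ := by
    intro s
    rw [DomAddAct.mk_vadd_toLp, ← MemLp.toLp_sub, Lp.norm_toLp, eLpNorm_one_eq_lintegral_enorm,
      ← integral_norm_eq_lintegral_enorm]
    · rfl
    · exact ((hF.comp_add_left s).sub hF).aestronglyMeasurable
  have h := hcont.tendsto 0
  simp only [key, zero_add, sub_self, norm_zero, integral_zero] at h
  exact h

lemma integrable_prod_mul_bounded_comp_affine {F g : ℝ → ℂ} (hF : Integrable F)
    (hgm : Measurable g) {C : ℝ} (hgC : ∀ x, ‖g x‖ ≤ C) (r : ℝ) (ν : Measure ℝ)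
    [IsFiniteMeasure ν] :
    Integrable (Function.uncurry fun s t => F t * g (r * t + s)) (ν.prod volume) := by
  refine Integrable.mul_bdd (c := C) (hF.comp_snd _) ?_ (.of_forall fun p => hgC _)
  exact (hgm.comp (by fun_prop)).aestronglyMeasurable

lemma integral_mul_eq_zero_of_periodic_mean_zero {F g : ℝ → ℂ} (hF : Integrable F)
    (hgm : Measurable g) {C : ℝ} (hgC : ∀ x, ‖g x‖ ≤ C) {T : ℝ}
    (hper : Function.Periodic g T) (hmean : (∫ x in (0 : ℝ)..T, g x) = 0) (r : ℝ) :
    ∫ s in (0 : ℝ)..T, ∫ t, F t * g (r * t + s) = 0 := by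
  rw [intervalIntegral_integral_swap]
  · have : ∀ t, ∫ s in (0 : ℝ)..T, F t * g (r * t + s) = 0 := by
      intro t
      rw [intervalIntegral.integral_const_mul,
        intervalIntegral.integral_comp_add_left (fun x => g x), add_zero,
        hper.intervalIntegral_add_eq (r * t) 0, zero_add, hmean, mul_zero]
    simp [this]
  · have : IsFiniteMeasure (volume.restrict (Set.uIoc 0 T)) := by
      unfold Set.uIoc
      infer_instance
    exact integrable_prod_mul_bounded_comp_affine hF hgm hgC r _

lemma norm_integral_mul_sub_le {F g : ℝ → ℂ} (hF : Integrable F)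
    (hgm : Measurable g) {C : ℝ} (hgC : ∀ x, ‖g x‖ ≤ C) {r : ℝ} (hr : r ≠ 0) (s : ℝ) :
    ‖(∫ t, F t * g (r * t)) - ∫ t, F t * g (r * t + s)‖ ≤
      C * ∫ t, ‖F (s / r + t) - F t‖ := by
  have htrans : ∫ t, F t * g (r * t) = ∫ t, F (s / r + t) * g (r * t + s) := by
    rw [← integral_add_left_eq_self _ (s / r)]
    congr! 4 with t
    field_simp
    ring
  have hgs : AEStronglyMeasurable (fun t => g (r * t + s)) :=
    (hgm.comp (by fun_prop)).aestronglyMeasurable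
  have hFs := hF.comp_add_left (s / r)
  rw [htrans, ← integral_sub (hFs.mul_bdd hgs (.of_forall fun _ => hgC _))
    (hF.mul_bdd hgs (.of_forall fun _ => hgC _)), ← integral_const_mul]
  refine norm_integral_le_of_norm_le ((hFs.sub hF).norm.const_mul C) (.of_forall fun t => ?_)
  rw [← sub_mul, norm_mul, mul_comm]
  gcongr
  exact hgC _

/-- The Riemann–Lebesgue lemma on the whole line, for an everywhere bounded periodic factor. -/
lemma tendsto_integral_mul_periodic {F g : ℝ → ℂ} (hF : Integrable F)
    (hgm : Measurable g) {C : ℝ} (hgC : ∀ x, ‖g x‖ ≤ C) {T : ℝ} (hT : 0 < T)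
    (hper : Function.Periodic g T) (hmean : (∫ x in (0 : ℝ)..T, g x) = 0) :
    Tendsto (fun r : ℝ => ∫ t, F t * g (r * t)) atTop (nhds 0) := by
  have hC : 0 ≤ C := (norm_nonneg _).trans (hgC 0)
  rw [Metric.tendsto_nhds]
  intro ε hε
  have hω := (tendsto_integral_norm_translate_sub hF).const_mul C
  rw [mul_zero] at hω
  obtain ⟨δ, hδ, hδω⟩ := Metric.eventually_nhds_iff.1 (hω.eventually_lt_const (half_pos hε))
  filter_upwards [eventually_gt_atTop (T / δ)] with r hr
  have hr0 : 0 < r := (div_pos hT hδ).trans hr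
  have hbound : ∀ s ∈ Set.uIoc 0 T,
      ‖(∫ t, F t * g (r * t)) - ∫ t, F t * g (r * t + s)‖ ≤ ε / 2 := by
    intro s hs
    rw [Set.uIoc_of_le hT.le] at hs
    refine (norm_integral_mul_sub_le hF hgm hgC hr0.ne' s).trans (hδω ?_).le
    rw [dist_zero_right, Real.norm_of_nonneg (div_nonneg hs.1.le hr0.le), div_lt_iff₀ hr0]
    rw [div_lt_iff₀ hδ] at hr
    linarith [hs.2]
  have h := intervalIntegral.norm_integral_le_of_norm_le_const hbound
  have hint : IntervalIntegrable (fun s => ∫ t, F t * g (r * t + s)) volume 0 T := by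
    rw [intervalIntegrable_iff_integrableOn_Ioc_of_le hT.le]
    exact (integrable_prod_mul_bounded_comp_affine hF hgm hgC r _).integral_prod_left
  rw [intervalIntegral.integral_sub (by simp) hint,
    integral_mul_eq_zero_of_periodic_mean_zero hF hgm hgC hper hmean,
    intervalIntegral.integral_const, sub_zero, sub_zero, norm_smul, Real.norm_of_nonneg hT.le,
    abs_of_pos hT, mul_comm] at h
  rw [dist_zero_right]
  linarith [le_of_mul_le_mul_right h hT]

/-- **Riemann–Lebesgue lemma** (Lemma 5): for `f ∈ L¹([a,b], ℂ)` and a bounded measurable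
`T`-periodic function `g` with mean zero, `∫_a^b f(t) g(nt) dt → 0` as `n → ∞`. -/
theorem riemann_lebesgue_periodic
    (a b : ℝ) (hab : a < b) (f : ℝ → ℂ) (hf : IntegrableOn f (Set.Icc a b) volume)
    (g : ℝ → ℂ) (hgm : Measurable g) (C : ℝ) (hgC : ∀ᵐ x ∂volume, ‖g x‖ ≤ C)
    (T : ℝ) (hT : 0 < T) (hper : Function.Periodic g T)
    (hmean : (∫ x in (0 : ℝ)..T, g x) = 0) :
    Tendsto (fun n : ℕ => ∫ t in a..b, f t * g (n * t)) atTop (nhds 0) := by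
  obtain ⟨x₀, hx₀⟩ := hgC.exists
  have hC : 0 ≤ C := (norm_nonneg _).trans hx₀
  let g' : ℝ → ℂ := Set.indicator {x | ‖g x‖ ≤ C} g
  have hgg' : g' =ᵐ[volume] g := hgC.mono fun x hx => Set.indicator_of_mem (s := {y | ‖g y‖ ≤ C}) hx g
  have hg'm : Measurable g' := hgm.indicator (measurableSet_le hgm.norm measurable_const)
  have hg'C : ∀ x, ‖g' x‖ ≤ C := fun x => by
    by_cases hx : ‖g x‖ ≤ C <;> simp [g', hx, hC]
  have hg'per : Function.Periodic g' T := fun x => by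
    simp only [g', Set.indicator, Set.mem_ofPred_eq, hper x]
  have hg'mean : (∫ x in (0 : ℝ)..T, g' x) = 0 := by
    rw [← hmean]
    exact intervalIntegral.integral_congr_ae (hgg'.mono fun x hx _ => hx)
  have hF : Integrable ((Set.Ioc a b).indicator f) :=
    (hf.mono_set Set.Ioc_subset_Icc_self).integrable_indicator measurableSet_Ioc
  refine ((tendsto_integral_mul_periodic hF hg'm hg'C hT hg'per hg'mean).comp
    tendsto_natCast_atTop_atTop).congr' ?_
  filter_upwards [eventually_gt_atTop 0] with n hn
  have hn' : (n : ℝ) ≠ 0 := by positivity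
  rw [intervalIntegral.integral_of_le hab.le, ← integral_indicator measurableSet_Ioc]
  refine integral_congr_ae ?_
  have hq : Measure.QuasiMeasurePreserving (fun t : ℝ => (n : ℝ) * t) volume volume :=
    ⟨measurable_const_mul _, by
      rw [Real.map_volume_mul_left hn']
      exact Measure.smul_absolutelyContinuous⟩
  filter_upwards [hq.ae_eq_comp hgg'] with t ht
  simp only [Function.comp_apply] at ht
  rw [ht, Set.indicator_mul_left]
end

section
/- For the thermal fermionic XX model with parameters a ∈ ℝ, b > 0 and every Renyi index α > 0, the high-temperature limit of the asymptotically exact mutual information satisfies lim_{β→0⁺} I_{α,∞}(β)/β² = α b²/(2 log 2). -/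
open Real Filter MeasureTheory

/-- Difference quotient of `g`, extended by the derivative on the diagonal. -/
noncomputable def dq (g : ℝ → ℝ) (u v : ℝ) : ℝ :=
  if u = v then deriv g u else (g u - g v) / (u - v)

/-- The symbol of the thermal fermionic XX chain: `λ_β(θ) = -tanh(β(a/2 + b cos θ))`. -/
noncomputable def lamXX (β a b θ : ℝ) : ℝ := - Real.tanh (β * (a / 2 + b * Real.cos θ))

/-- The asymptotically exact Renyi-α mutual information of the bisected thermal XX chain. -/
noncomputable def IalphaInf (α a b β : ℝ) : ℝ :=
  (1 / (4 * π ^ 2)) * ∫ φ in (-π)..π, ∫ θ in (-π)..π,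
    dq (sFun α) (lamXX β a b θ) (lamXX β a b φ) *
      ((deriv (lamXX β a b) φ - deriv (lamXX β a b) θ) / Real.tan ((φ - θ) / 2))

lemma dq_sub_linear_le {g : ℝ → ℝ} {c ε : ℝ} (hd : ∀ᶠ x in nhds 0, DifferentiableAt ℝ g x)
    (h0 : deriv g 0 = 0) (h2 : HasDerivAt (deriv g) c 0) (hε : 0 < ε) :
    ∃ δ > 0, ∀ u v, |u| < δ → |v| < δ → |dq g u v - c * (u + v) / 2| ≤ ε * (|u| + |v|) := by
  have hlin : ∀ᶠ x in nhds 0, |deriv g x - c * x| ≤ ε * |x| := by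
    have h := (hasDerivAt_iff_isLittleO.1 h2).def hε
    simpa [h0, mul_comm] using h
  obtain ⟨δ, hδ, H⟩ := Metric.eventually_nhds_iff.1 (hd.and hlin)
  refine ⟨δ, hδ, fun u v hu hv => ?_⟩
  by_cases huv : u = v
  · subst huv
    have := (H (y := u) (by simpa using hu)).2
    simp only [dq, if_true]
    rw [show c * (u + u) / 2 = c * u by ring]
    nlinarith [abs_nonneg u]
  · set r := max |u| |v|
    have hr : r < δ := max_lt hu hv
    have key := (convex_Icc (-r) r).norm_image_sub_le_of_norm_hasDerivWithin_le
      (f := fun x => g x - c * x ^ 2 / 2) (f' := fun x => deriv g x - c * x) (C := ε * r)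
      (x := v) (y := u) (fun x hx => ?_) (fun x hx => ?_)
      (abs_le.1 (le_max_right _ _)) (abs_le.1 (le_max_left _ _))
    · have hne : u - v ≠ 0 := sub_ne_zero.2 huv
      have hpos : 0 < |u - v| := abs_pos.2 hne
      have e : dq g u v - c * (u + v) / 2
          = (g u - c * u ^ 2 / 2 - (g v - c * v ^ 2 / 2)) / (u - v) := by
        simp only [dq, if_neg huv]
        field_simp
        ring
      rw [e, abs_div, div_le_iff₀ hpos]
      refine key.trans ?_
      rw [Real.norm_eq_abs]
      have : r ≤ |u| + |v| := max_le (by linarith [abs_nonneg v]) (by linarith [abs_nonneg u])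
      gcongr
    · have hx' : |x| < δ := (abs_le.2 hx).trans_lt hr
      have hg := (H (y := x) (by simpa using hx')).1.hasDerivAt
      have hq : HasDerivAt (fun x : ℝ => c * x ^ 2 / 2) (c * x) x := by
        have := ((hasDerivAt_pow 2 x).const_mul c).div_const 2
        refine this.congr_deriv ?_
        push_cast
        ring
      exact (hg.sub hq).hasDerivWithinAt
    · have hx' : |x| ≤ r := abs_le.2 hx
      refine ((H (y := x) (by simpa using hx'.trans_lt hr)).2).trans ?_
      gcongr

lemma hasDerivAt_half_add (x : ℝ) : HasDerivAt (fun x : ℝ => (1 + x) / 2) (1 / 2) x :=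
  ((hasDerivAt_id x).const_add 1).div_const 2

lemma hasDerivAt_half_sub (x : ℝ) : HasDerivAt (fun x : ℝ => (1 - x) / 2) (-1 / 2) x :=
  ((hasDerivAt_id x).const_sub 1).div_const 2

lemma hasDerivAt_sFun_one {x : ℝ} (h1 : 0 < 1 + x) (h2 : 0 < 1 - x) :
    HasDerivAt (sFun 1)
      (1 / (2 * Real.log 2) * (Real.log ((1 - x) / 2) - Real.log ((1 + x) / 2))) x := by
  have hl : Real.log 2 ≠ 0 := (Real.log_pos one_lt_two).ne'
  have hp := hasDerivAt_half_add x
  have hm := hasDerivAt_half_sub x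
  have hp0 : (1 + x) / 2 ≠ 0 := by positivity
  have hm0 : (1 - x) / 2 ≠ 0 := by positivity
  have h := (hp.mul ((hp.log hp0).div_const (Real.log 2))).neg.sub
    (hm.mul ((hm.log hm0).div_const (Real.log 2)))
  have e : sFun 1 = fun x => -(((1 + x) / 2) * (Real.log ((1 + x) / 2) / Real.log 2))
      - ((1 - x) / 2) * (Real.log ((1 - x) / 2) / Real.log 2) := by
    funext x
    simp [sFun, Real.logb]
  rw [e]
  refine h.congr_deriv ?_
  field_simp
  ring

lemma hasDerivAt_sFun_of_ne_one {α x : ℝ} (hα : α ≠ 1) (h1 : 0 < 1 + x) (h2 : 0 < 1 - x) :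
    HasDerivAt (sFun α)
      (α / (2 * (1 - α) * Real.log 2) * ((((1 + x) / 2) ^ (α - 1) - ((1 - x) / 2) ^ (α - 1)) /
        (((1 + x) / 2) ^ α + ((1 - x) / 2) ^ α))) x := by
  have hl : Real.log 2 ≠ 0 := (Real.log_pos one_lt_two).ne'
  have hα' : 1 - α ≠ 0 := sub_ne_zero.2 hα.symm
  have hp0 : 0 < (1 + x) / 2 := by positivity
  have hm0 : 0 < (1 - x) / 2 := by positivity
  have hp := (hasDerivAt_half_add x).rpow_const (p := α) (Or.inl hp0.ne')
  have hm := (hasDerivAt_half_sub x).rpow_const (p := α) (Or.inl hm0.ne')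
  have hD : ((1 + x) / 2) ^ α + ((1 - x) / 2) ^ α ≠ 0 := by positivity
  have h := (((hp.add hm).log hD).div_const (Real.log 2)).const_mul (1 / (1 - α))
  have e : sFun α = fun x => 1 / (1 - α) *
      (Real.log (((1 + x) / 2) ^ α + ((1 - x) / 2) ^ α) / Real.log 2) := by
    funext x
    simp [sFun, Real.logb, hα]
  rw [e]
  refine h.congr_deriv ?_
  simp only [Pi.add_apply]
  field_simp
  ring

lemma eventually_one_add_sub_pos : ∀ᶠ x : ℝ in nhds 0, 0 < 1 + x ∧ 0 < 1 - x := by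
  filter_upwards [Ioo_mem_nhds (show (-1 : ℝ) < 0 by norm_num) one_pos] with x hx
  exact ⟨by linarith [hx.1], by linarith [hx.2]⟩

lemma eventually_differentiableAt_sFun (α : ℝ) :
    ∀ᶠ x in nhds 0, DifferentiableAt ℝ (sFun α) x := by
  filter_upwards [eventually_one_add_sub_pos] with x hx
  by_cases hα : α = 1
  · subst hα
    exact (hasDerivAt_sFun_one hx.1 hx.2).differentiableAt
  · exact (hasDerivAt_sFun_of_ne_one hα hx.1 hx.2).differentiableAt

lemma deriv_sFun_zero (α : ℝ) : deriv (sFun α) 0 = 0 := by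
  by_cases hα : α = 1
  · subst hα
    simp [(hasDerivAt_sFun_one (x := 0) (by simp) (by simp)).deriv]
  · simp [(hasDerivAt_sFun_of_ne_one (x := 0) hα (by simp) (by simp)).deriv]

lemma hasDerivAt_deriv_sFun_zero (α : ℝ) :
    HasDerivAt (deriv (sFun α)) (-α / Real.log 2) 0 := by
  have hl : Real.log 2 ≠ 0 := (Real.log_pos one_lt_two).ne'
  have hp := hasDerivAt_half_add 0
  have hm := hasDerivAt_half_sub 0
  by_cases hα : α = 1
  · subst hα
    have h := ((hm.log (by norm_num)).sub (hp.log (by norm_num))).const_mul (1 / (2 * Real.log 2))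
    refine HasDerivAt.congr_of_eventuallyEq (f := fun x =>
      1 / (2 * Real.log 2) * (Real.log ((1 - x) / 2) - Real.log ((1 + x) / 2))) ?_ ?_
    · refine h.congr_deriv ?_
      field_simp
      norm_num
    · filter_upwards [eventually_one_add_sub_pos] with x hx
      exact (hasDerivAt_sFun_one hx.1 hx.2).deriv
  · have hα' : 1 - α ≠ 0 := sub_ne_zero.2 (Ne.symm hα)
    have hN := (hp.rpow_const (p := α - 1) (Or.inl (by norm_num))).sub
      (hm.rpow_const (p := α - 1) (Or.inl (by norm_num)))
    have hD := (hp.rpow_const (p := α) (Or.inl (by norm_num))).add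
      (hm.rpow_const (p := α) (Or.inl (by norm_num)))
    have hne : (fun x : ℝ => ((1 + x) / 2) ^ α + ((1 - x) / 2) ^ α) 0 ≠ 0 := by
      simp only [add_zero, sub_zero]
      positivity
    have h := (hN.div hD hne).const_mul (α / (2 * (1 - α) * Real.log 2))
    refine HasDerivAt.congr_of_eventuallyEq (f := fun x => α / (2 * (1 - α) * Real.log 2) *
      ((((1 + x) / 2) ^ (α - 1) - ((1 - x) / 2) ^ (α - 1)) /
        (((1 + x) / 2) ^ α + ((1 - x) / 2) ^ α))) ?_ ?_
    · refine h.congr_deriv ?_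
      have hP : (0 : ℝ) < (1 / 2) ^ α := by positivity
      simp only [Pi.add_apply, Pi.sub_apply, add_zero, sub_zero]
      rw [Real.rpow_sub_one (x := 1 / 2) (by norm_num) (α - 1),
        Real.rpow_sub_one (x := 1 / 2) (by norm_num) α]
      field_simp
      ring
    · filter_upwards [eventually_one_add_sub_pos] with x hx
      exact (hasDerivAt_sFun_of_ne_one hα hx.1 hx.2).deriv

lemma hasDerivAt_tanh (x : ℝ) : HasDerivAt Real.tanh (1 - Real.tanh x ^ 2) x := by
  have hc := (Real.cosh_pos x).ne'
  have h := (Real.hasDerivAt_sinh x).div (Real.hasDerivAt_cosh x) hc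
  rw [show Real.tanh = Real.sinh / Real.cosh from funext Real.tanh_eq_sinh_div_cosh]
  refine h.congr_deriv ?_
  simp only [Pi.div_apply]
  field_simp

lemma abs_tanh_sub_tanh_le (x y : ℝ) : |Real.tanh x - Real.tanh y| ≤ |x - y| := by
  have h := convex_univ.norm_image_sub_le_of_norm_hasDerivWithin_le (f := Real.tanh)
    (f' := fun x => 1 - Real.tanh x ^ 2) (C := 1) (x := y) (y := x)
    (fun z _ => (hasDerivAt_tanh z).hasDerivWithinAt) (fun z _ => ?_) trivial trivial
  · simpa using h
  · rw [Real.norm_eq_abs, abs_le]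
    constructor <;> nlinarith [Real.tanh_sq_lt_one z, sq_nonneg (Real.tanh z)]

lemma abs_half_add_mul_cos_le {b : ℝ} (hb : 0 < b) (a θ : ℝ) :
    |a / 2 + b * Real.cos θ| ≤ |a| / 2 + b := by
  refine (abs_add_le _ _).trans ?_
  rw [abs_div, abs_mul, abs_of_pos hb, abs_two]
  nlinarith [Real.abs_cos_le_one θ]

lemma abs_lamXX_le {b β : ℝ} (hb : 0 < b) (hβ : 0 < β) (a θ : ℝ) :
    |lamXX β a b θ| ≤ β * (|a| / 2 + b) := by
  have h := abs_tanh_sub_tanh_le (β * (a / 2 + b * Real.cos θ)) 0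
  rw [Real.tanh_zero, sub_zero, sub_zero, abs_mul, abs_of_pos hβ] at h
  rw [lamXX, abs_neg]
  exact h.trans (by gcongr; exact abs_half_add_mul_cos_le hb a θ)

lemma hasDerivAt_lamXX (β a b θ : ℝ) :
    HasDerivAt (lamXX β a b) ((1 - lamXX β a b θ ^ 2) * (β * b * Real.sin θ)) θ := by
  have h := (hasDerivAt_tanh (β * (a / 2 + b * Real.cos θ))).comp θ
    ((((Real.hasDerivAt_cos θ).const_mul b).const_add (a / 2)).const_mul β)
  refine h.neg.congr_deriv ?_
  simp only [lamXX]
  ring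

lemma tendsto_lamXX_div (a b θ : ℝ) :
    Tendsto (fun β => lamXX β a b θ / β) (nhdsWithin 0 (Set.Ioi 0))
      (nhds (-(a / 2 + b * Real.cos θ))) := by
  have h := (hasDerivAt_tanh (0 * (a / 2 + b * Real.cos θ))).comp (0 : ℝ)
    ((hasDerivAt_id (0 : ℝ)).mul_const (a / 2 + b * Real.cos θ))
  have h' : HasDerivAt (fun β => lamXX β a b θ) (-(a / 2 + b * Real.cos θ)) 0 :=
    h.neg.congr_deriv (by simp)
  have hs := hasDerivAt_iff_tendsto_slope_zero.1 h'
  refine (hs.mono_left (nhdsWithin_mono _ fun x hx => ne_of_gt hx)).congr fun β => ?_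
  simp [lamXX, div_eq_inv_mul]

lemma abs_kernel_sub_le {b β : ℝ} (hb : 0 < b) (hβ : 0 < β) (a : ℝ) {φ θ : ℝ}
    (hs : Real.sin ((φ - θ) / 2) ≠ 0) :
    |(deriv (lamXX β a b) φ - deriv (lamXX β a b) θ) / Real.tan ((φ - θ) / 2)
        - β * (b * (Real.cos φ + Real.cos θ))| ≤
      β ^ 3 * (b * (2 * (|a| / 2 + b) ^ 2 + 4 * b * (|a| / 2 + b))) := by
  rw [(hasDerivAt_lamXX β a b φ).deriv, (hasDerivAt_lamXX β a b θ).deriv]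
  have hu := abs_lamXX_le hb hβ a φ
  have hv := abs_lamXX_le hb hβ a θ
  have hvu : |(lamXX β a b θ - lamXX β a b φ) / Real.tan ((φ - θ) / 2)| ≤ 2 * (β * b) := by
    have h := abs_tanh_sub_tanh_le (β * (a / 2 + b * Real.cos φ)) (β * (a / 2 + b * Real.cos θ))
    rw [show β * (a / 2 + b * Real.cos φ) - β * (a / 2 + b * Real.cos θ)
        = β * b * (Real.cos φ - Real.cos θ) by ring, Real.cos_sub_cos, abs_mul, abs_of_pos (mul_pos hβ hb),
      abs_mul, abs_mul] at h
    rw [Real.tan_eq_sin_div_cos, div_div_eq_mul_div, abs_div, abs_mul,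
      div_le_iff₀ (abs_pos.2 hs)]
    have h1 : |lamXX β a b θ - lamXX β a b φ| ≤ 2 * (β * b) * |Real.sin ((φ - θ) / 2)| := by
      rw [show lamXX β a b θ - lamXX β a b φ = Real.tanh (β * (a / 2 + b * Real.cos φ))
        - Real.tanh (β * (a / 2 + b * Real.cos θ)) by simp only [lamXX]; ring]
      refine h.trans ?_
      rw [show |(-2 : ℝ)| = 2 by norm_num]
      have := mul_le_mul_of_nonneg_left (Real.abs_sin_le_one ((φ + θ) / 2))
        (show 0 ≤ 2 * (β * b) * |Real.sin ((φ - θ) / 2)| by positivity)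
      linarith
    refine (mul_le_mul h1 (Real.abs_cos_le_one _) (abs_nonneg _) (by positivity)).trans ?_
    rw [mul_one]
  have hsin : (Real.sin φ - Real.sin θ) / Real.tan ((φ - θ) / 2) = Real.cos φ + Real.cos θ := by
    rw [Real.sin_sub_sin, Real.cos_add_cos, Real.tan_eq_sin_div_cos, div_div_eq_mul_div]
    field_simp
  set u := lamXX β a b φ
  set v := lamXX β a b θ
  set M := |a| / 2 + b
  have e : ((1 - u ^ 2) * (β * b * Real.sin φ) - (1 - v ^ 2) * (β * b * Real.sin θ))
        / Real.tan ((φ - θ) / 2) - β * (b * (Real.cos φ + Real.cos θ))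
      = β * b * (-(u ^ 2 * (Real.cos φ + Real.cos θ))
        + Real.sin θ * (v + u) * ((v - u) / Real.tan ((φ - θ) / 2))) := by
    rw [← hsin]
    ring
  have hM : 0 ≤ M := by positivity
  have hsq : u ^ 2 ≤ (β * M) ^ 2 := sq_le_sq' (abs_le.1 hu).1 (abs_le.1 hu).2
  have hcos : |Real.cos φ + Real.cos θ| ≤ 2 :=
    (abs_add_le _ _).trans (by linarith [Real.abs_cos_le_one φ, Real.abs_cos_le_one θ])
  have hadd : |v + u| ≤ 2 * (β * M) := (abs_add_le _ _).trans (by linarith)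
  have t1 : |-(u ^ 2 * (Real.cos φ + Real.cos θ))| ≤ (β * M) ^ 2 * 2 := by
    rw [abs_neg, abs_mul, abs_of_nonneg (sq_nonneg u)]
    gcongr
  have t2 : |Real.sin θ * (v + u) * ((v - u) / Real.tan ((φ - θ) / 2))|
      ≤ 1 * (2 * (β * M)) * (2 * (β * b)) := by
    rw [abs_mul, abs_mul]
    gcongr
    exact Real.abs_sin_le_one θ
  rw [e, abs_mul, abs_of_pos (mul_pos hβ hb)]
  calc β * b * |_| ≤ β * b * ((β * M) ^ 2 * 2 + 1 * (2 * (β * M)) * (2 * (β * b))) := by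
        gcongr
        exact (abs_add_le _ _).trans (add_le_add t1 t2)
    _ = _ := by ring

lemma measurable_sFun (α : ℝ) : Measurable (sFun α) := by
  unfold sFun Real.logb
  split_ifs <;> fun_prop

lemma measurable_dq {g : ℝ → ℝ} (hg : Measurable g) : Measurable fun p : ℝ × ℝ => dq g p.1 p.2 := by
  unfold dq
  have hd := measurable_deriv g
  exact Measurable.ite (measurableSet_eq_fun measurable_fst measurable_snd) (by fun_prop)
    (by fun_prop)

/-- The integrand of `IalphaInf`, divided by `β ^ 2`. -/
noncomputable def rescaledIntegrand (α a b β φ θ : ℝ) : ℝ :=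
  dq (sFun α) (lamXX β a b θ) (lamXX β a b φ) / β *
    ((deriv (lamXX β a b) φ - deriv (lamXX β a b) θ) / Real.tan ((φ - θ) / 2) / β)

lemma measurable_rescaledIntegrand (α a b β : ℝ) :
    Measurable (Function.uncurry (rescaledIntegrand α a b β)) := by
  have hl : Measurable (lamXX β a b) :=
    Continuous.measurable (continuous_iff_continuousAt.2 fun θ =>
      (hasDerivAt_lamXX β a b θ).continuousAt)
  have hd := measurable_deriv (lamXX β a b)
  have hq : Measurable fun p : ℝ × ℝ => dq (sFun α) (lamXX β a b p.2) (lamXX β a b p.1) :=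
    (measurable_dq (measurable_sFun α)).comp
      ((hl.comp measurable_snd).prodMk (hl.comp measurable_fst))
  have ht : Measurable fun p : ℝ × ℝ => Real.tan ((p.1 - p.2) / 2) := by
    simp only [Real.tan_eq_sin_div_cos]
    fun_prop
  have hk : Measurable fun p : ℝ × ℝ => deriv (lamXX β a b) p.1 - deriv (lamXX β a b) p.2 :=
    (hd.comp measurable_fst).sub (hd.comp measurable_snd)
  exact (hq.div_const β).mul ((hk.div ht).div_const β)

lemma IalphaInf_div_sq (α a b β : ℝ) :
    IalphaInf α a b β / β ^ 2 =
      (1 / (4 * π ^ 2)) * ∫ φ in (-π)..π, ∫ θ in (-π)..π, rescaledIntegrand α a b β φ θ := by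
  rw [IalphaInf, mul_div_assoc, ← intervalIntegral.integral_div]
  simp only [← intervalIntegral.integral_div]
  congr! 5 with φ θ
  rw [rescaledIntegrand]
  ring

lemma ae_sin_half_sub_ne_zero (φ : ℝ) : ∀ᵐ θ : ℝ, Real.sin ((φ - θ) / 2) ≠ 0 := by
  have hc : (Set.range fun n : ℤ => φ - 2 * (n * π)).Countable := Set.countable_range _
  filter_upwards [hc.ae_notMem volume] with θ hθ h
  obtain ⟨n, hn⟩ := Real.sin_eq_zero_iff.1 h
  exact hθ ⟨n, by simp only [hn]; ring⟩

lemma eventually_abs_dq_lamXX_sub_le {b ε : ℝ} (hb : 0 < b) (hε : 0 < ε) (α a : ℝ) :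
    ∀ᶠ β : ℝ in nhdsWithin 0 (Set.Ioi 0), ∀ φ θ,
      |dq (sFun α) (lamXX β a b θ) (lamXX β a b φ) / β
        - -α / Real.log 2 * (lamXX β a b θ / β + lamXX β a b φ / β) / 2| ≤
          ε * (2 * (|a| / 2 + b)) := by
  obtain ⟨δ, hδ, H⟩ := dq_sub_linear_le (eventually_differentiableAt_sFun α) (deriv_sFun_zero α)
    (hasDerivAt_deriv_sFun_zero α) hε
  have hM : 0 < |a| / 2 + b := by positivity
  filter_upwards [Ioo_mem_nhdsGT (div_pos hδ hM)] with β hβ φ θ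
  have hβ0 : 0 < β := hβ.1
  have hlt : β * (|a| / 2 + b) < δ := (lt_div_iff₀ hM).1 hβ.2
  have hu := abs_lamXX_le hb hβ0 a θ
  have hv := abs_lamXX_le hb hβ0 a φ
  have h := H _ _ (hu.trans_lt hlt) (hv.trans_lt hlt)
  rw [← add_div, ← mul_div_assoc, div_right_comm _ β, ← sub_div, abs_div, abs_of_pos hβ0,
    div_le_iff₀ hβ0]
  refine h.trans ?_
  calc ε * (|lamXX β a b θ| + |lamXX β a b φ|)
      ≤ ε * (β * (|a| / 2 + b) + β * (|a| / 2 + b)) := by gcongr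
    _ = _ := by ring

lemma tendsto_dq_lamXX_div {b : ℝ} (hb : 0 < b) (α a φ θ : ℝ) :
    Tendsto (fun β => dq (sFun α) (lamXX β a b θ) (lamXX β a b φ) / β)
      (nhdsWithin 0 (Set.Ioi 0))
      (nhds (α / (2 * Real.log 2) * (a + b * (Real.cos φ + Real.cos θ)))) := by
  have hM : 0 < |a| / 2 + b := by positivity
  have hdiff : Tendsto (fun β => dq (sFun α) (lamXX β a b θ) (lamXX β a b φ) / β
      - -α / Real.log 2 * (lamXX β a b θ / β + lamXX β a b φ / β) / 2)
      (nhdsWithin 0 (Set.Ioi 0)) (nhds 0) := by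
    rw [Metric.tendsto_nhds]
    intro η hη
    have hε : 0 < η / (4 * (|a| / 2 + b)) := by positivity
    filter_upwards [eventually_abs_dq_lamXX_sub_le hb hε α a] with β hβ
    rw [Real.dist_eq, sub_zero]
    refine (hβ φ θ).trans_lt ?_
    field_simp
    norm_num
  have hlin := ((((tendsto_lamXX_div a b θ).add (tendsto_lamXX_div a b φ)).const_mul
    (-α / Real.log 2)).div_const 2)
  have h := hdiff.add hlin
  simp only [sub_add_cancel] at h
  convert h using 2
  ring

lemma tendsto_kernel_div {b : ℝ} (hb : 0 < b) (a : ℝ) {φ θ : ℝ}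
    (hs : Real.sin ((φ - θ) / 2) ≠ 0) :
    Tendsto (fun β => (deriv (lamXX β a b) φ - deriv (lamXX β a b) θ) / Real.tan ((φ - θ) / 2) / β)
      (nhdsWithin 0 (Set.Ioi 0)) (nhds (b * (Real.cos φ + Real.cos θ))) := by
  set K := b * (2 * (|a| / 2 + b) ^ 2 + 4 * b * (|a| / 2 + b))
  have hz : Tendsto (fun β : ℝ => β ^ 2 * K) (nhdsWithin 0 (Set.Ioi 0)) (nhds 0) := by
    have : Continuous fun β : ℝ => β ^ 2 * K := by fun_prop
    simpa using (this.tendsto 0).mono_left nhdsWithin_le_nhds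
  rw [← tendsto_sub_nhds_zero_iff]
  refine squeeze_zero_norm' ?_ hz
  filter_upwards [self_mem_nhdsWithin] with β hβ
  have hβ0 : 0 < β := hβ
  have h := abs_kernel_sub_le hb hβ0 a hs
  rw [Real.norm_eq_abs, div_sub' hβ0.ne', abs_div, abs_of_pos hβ0, div_le_iff₀ hβ0]
  refine h.trans (le_of_eq ?_)
  ring

lemma tendsto_rescaledIntegrand {b : ℝ} (hb : 0 < b) (α a : ℝ) {φ θ : ℝ}
    (hs : Real.sin ((φ - θ) / 2) ≠ 0) :
    Tendsto (fun β => rescaledIntegrand α a b β φ θ) (nhdsWithin 0 (Set.Ioi 0))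
      (nhds (α / (2 * Real.log 2) * (a + b * (Real.cos φ + Real.cos θ)) *
        (b * (Real.cos φ + Real.cos θ)))) :=
  (tendsto_dq_lamXX_div hb α a φ θ).mul (tendsto_kernel_div hb a hs)

lemma exists_bound_rescaledIntegrand {b : ℝ} (hb : 0 < b) (α a : ℝ) :
    ∃ C, ∀ᶠ β : ℝ in nhdsWithin 0 (Set.Ioi 0), ∀ φ θ, Real.sin ((φ - θ) / 2) ≠ 0 →
      |rescaledIntegrand α a b β φ θ| ≤ C := by
  set M := |a| / 2 + b
  have hM : 0 < M := by positivity
  set K := b * (2 * M ^ 2 + 4 * b * M)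
  set c := -α / Real.log 2
  refine ⟨(1 * (2 * M) + |c| * M) * (K + b * 2), ?_⟩
  filter_upwards [eventually_abs_dq_lamXX_sub_le hb one_pos α a,
    Ioo_mem_nhdsGT (show (0 : ℝ) < 1 by norm_num)] with β hdq hβ φ θ hs
  have hβ0 : 0 < β := hβ.1
  have hl : ∀ x, |lamXX β a b x / β| ≤ M := fun x => by
    rw [abs_div, abs_of_pos hβ0, div_le_iff₀ hβ0, mul_comm]
    exact abs_lamXX_le hb hβ0 a x
  have hker := abs_kernel_sub_le hb hβ0 a hs
  rw [rescaledIntegrand, abs_mul]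
  refine mul_le_mul ?_ ?_ (abs_nonneg _) (by positivity)
  · refine (sub_le_iff_le_add.1 ((abs_sub_abs_le_abs_sub _ _).trans (hdq φ θ))).trans ?_
    gcongr
    rw [abs_div, abs_mul, abs_two, mul_div_assoc]
    gcongr
    linarith [abs_add_le (lamXX β a b θ / β) (lamXX β a b φ / β), hl θ, hl φ]
  · rw [abs_div, abs_of_pos hβ0, div_le_iff₀ hβ0]
    refine (sub_le_iff_le_add.1 ((abs_sub_abs_le_abs_sub _ _).trans hker)).trans ?_
    have hcos : |Real.cos φ + Real.cos θ| ≤ 2 :=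
      (abs_add_le _ _).trans (by linarith [Real.abs_cos_le_one φ, Real.abs_cos_le_one θ])
    rw [abs_mul, abs_mul, abs_of_pos hβ0, abs_of_pos hb, add_mul, mul_comm _ β, mul_comm _ β]
    have h3 : β ^ 3 ≤ β := by
      simpa using pow_le_pow_of_le_one hβ0.le hβ.2.le (show 1 ≤ 3 by norm_num)
    gcongr

lemma integral_limit_integrand (k a b : ℝ) :
    ∫ φ in (-π)..π, ∫ θ in (-π)..π, k * (a + b * (Real.cos φ + Real.cos θ)) *
        (b * (Real.cos φ + Real.cos θ)) = 4 * π ^ 2 * (k * b ^ 2) := by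
  have hone : ∀ A B C : ℝ, ∫ θ in (-π)..π, (A + B * Real.cos θ + C * Real.cos θ ^ 2)
      = 2 * π * A + π * C := fun A B C => by
    rw [intervalIntegral.integral_add (Continuous.intervalIntegrable (by fun_prop) _ _)
      (Continuous.intervalIntegrable (by fun_prop) _ _),
      intervalIntegral.integral_add (Continuous.intervalIntegrable (by fun_prop) _ _)
      (Continuous.intervalIntegrable (by fun_prop) _ _)]
    simp only [intervalIntegral.integral_const_mul, intervalIntegral.integral_const, integral_cos,
      integral_cos_sq, Real.sin_pi, Real.sin_neg, smul_eq_mul]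
    ring
  have hin : ∀ φ : ℝ, ∫ θ in (-π)..π, k * (a + b * (Real.cos φ + Real.cos θ)) *
      (b * (Real.cos φ + Real.cos θ)) = π * (k * b ^ 2) + 2 * π * (k * a * b) * Real.cos φ
        + 2 * π * (k * b ^ 2) * Real.cos φ ^ 2 := fun φ => by
    rw [← sub_eq_zero, ← sub_eq_zero.2 (hone (k * b * (a * Real.cos φ + b * Real.cos φ ^ 2))
      (k * b * (a + 2 * b * Real.cos φ)) (k * b ^ 2))]
    congr 1
    · congr 1 with θ
      ring
    · ring
  simp only [hin, hone]
  ring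

/-- **High-temperature asymptotics of the XX mutual information** (Theorem 4, Eq. (49)):
`I_{α,∞}(β)/β² → α b²/(2 log 2)` as `β → 0⁺`. -/
theorem xx_high_temperature_limit (a b α : ℝ) (hb : 0 < b) (hα : 0 < α) :
    Tendsto (fun β : ℝ => IalphaInf α a b β / β ^ 2)
      (nhdsWithin 0 (Set.Ioi 0)) (nhds (α * b ^ 2 / (2 * Real.log 2))) := by
  obtain ⟨C, hC⟩ := exists_bound_rescaledIntegrand hb α a
  have hmeas := measurable_rescaledIntegrand α a b
  have hinner : ∀ φ, Tendsto (fun β => ∫ θ in (-π)..π, rescaledIntegrand α a b β φ θ)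
      (nhdsWithin 0 (Set.Ioi 0)) (nhds (∫ θ in (-π)..π, α / (2 * Real.log 2) *
        (a + b * (Real.cos φ + Real.cos θ)) * (b * (Real.cos φ + Real.cos θ)))) := fun φ => by
    refine intervalIntegral.tendsto_integral_filter_of_dominated_convergence (fun _ => C)
      (Eventually.of_forall fun β =>
        ((hmeas β).comp measurable_prodMk_left).aestronglyMeasurable) ?_
      intervalIntegrable_const ?_
    · filter_upwards [hC] with β hβ
      filter_upwards [ae_sin_half_sub_ne_zero φ] with θ hθ _
      exact hβ φ θ hθ
    · filter_upwards [ae_sin_half_sub_ne_zero φ] with θ hθ _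
      exact tendsto_rescaledIntegrand hb α a hθ
  have houter := intervalIntegral.tendsto_integral_filter_of_dominated_convergence
    (μ := volume) (a := -π) (b := π) (l := nhdsWithin 0 (Set.Ioi 0))
    (F := fun β φ => ∫ θ in (-π)..π, rescaledIntegrand α a b β φ θ)
    (fun _ => C * |π - -π|)
    (Eventually.of_forall fun β => by
      simp only [intervalIntegral.integral_of_le (show -π ≤ π by linarith [Real.pi_pos])]
      exact (hmeas β).stronglyMeasurable.integral_prod_right.aestronglyMeasurable)
    (by
      filter_upwards [hC] with β hβ
      refine Eventually.of_forall fun φ _ =>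
        intervalIntegral.norm_integral_le_of_norm_le_const_ae ?_
      filter_upwards [ae_sin_half_sub_ne_zero φ] with θ hθ _
      exact hβ φ θ hθ)
    intervalIntegrable_const (Eventually.of_forall fun φ _ => hinner φ)
  rw [integral_limit_integrand] at houter
  simp only [IalphaInf_div_sq]
  convert houter.const_mul (1 / (4 * π ^ 2)) using 2
  field_simp
end

section
/- For the thermal fermionic XX model with parameters a ∈ ℝ, b > 0 satisfying |a| < 2b (the critical phase), and for every Renyi index α > 0, the low-temperature growth of the asymptotically exact mutual information is at most logarithmic: limsup_{β→∞} I_{α,∞}(β)/log β ≤ (2α/(π² log 2 · (min{1,α})²)) · min{ 27/(2 min{1,α}), 4/|1−α| }, where for α = 1 the minimum is understood to be 27/(2 min{1,α}). -/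
open Real Filter MeasureTheory

lemma tanh_eq_exp_two_mul (x : ℝ) :
    Real.tanh x = (Real.exp (2 * x) - 1) / (Real.exp (2 * x) + 1) := by
  have h : Real.exp (2 * x) = Real.exp x * Real.exp x := by rw [← Real.exp_add]; ring_nf
  have h' : Real.exp x * Real.exp (-x) = 1 := by rw [← Real.exp_add]; simp
  have hx := Real.exp_pos x
  have hy := Real.exp_pos (-x)
  rw [Real.tanh_eq_sinh_div_cosh, Real.sinh_eq, Real.cosh_eq, h,
    div_div_div_cancel_right₀ two_ne_zero, div_eq_div_iff (by positivity) (by positivity)]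
  linear_combination (-2 * Real.exp x) * h'

lemma one_add_neg_tanh_div_two (x : ℝ) :
    (1 + -Real.tanh x) / 2 = Real.exp (-2 * x) / (1 + Real.exp (-2 * x)) := by
  have hx := Real.exp_pos (2 * x)
  rw [tanh_eq_exp_two_mul, neg_mul, Real.exp_neg]
  field_simp
  ring

lemma one_sub_neg_tanh_div_two (x : ℝ) :
    (1 - -Real.tanh x) / 2 = 1 / (1 + Real.exp (-2 * x)) := by
  have h := one_add_neg_tanh_div_two x
  have hy := Real.exp_pos (-2 * x)
  have : (1 - -Real.tanh x) / 2 = 1 - (1 + -Real.tanh x) / 2 := by ring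
  rw [this, h]
  field_simp
  ring

lemma sFun_neg (α y : ℝ) : sFun α (-y) = sFun α y := by
  unfold sFun
  split_ifs
  · simp only [sub_neg_eq_add, ← sub_eq_add_neg]
    ring
  · simp only [sub_neg_eq_add, ← sub_eq_add_neg]
    rw [add_comm]

lemma sFun_neg_tanh_abs (α u : ℝ) : sFun α (-Real.tanh |u|) = sFun α (-Real.tanh u) := by
  rcases abs_cases u with ⟨h, _⟩ | ⟨h, _⟩ <;> rw [h]
  rw [Real.tanh_neg, sFun_neg]

lemma sFun_neg_tanh_of_ne_one {α : ℝ} (hα : α ≠ 1) (x : ℝ) :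
    sFun α (-Real.tanh x) = (Real.log (1 + Real.exp (-2 * (α * x)))
      - α * Real.log (1 + Real.exp (-2 * x))) / ((1 - α) * Real.log 2) := by
  have hy := Real.exp_pos (-2 * x)
  have hy' := Real.exp_pos (-2 * x * α)
  have hα' : 1 - α ≠ 0 := sub_ne_zero.mpr hα.symm
  have hl : Real.log 2 ≠ 0 := (Real.log_pos one_lt_two).ne'
  unfold sFun
  rw [if_neg hα, one_add_neg_tanh_div_two, one_sub_neg_tanh_div_two,
    Real.div_rpow hy.le (by positivity), Real.div_rpow zero_le_one (by positivity),
    Real.one_rpow, ← add_div, ← Real.exp_mul, Real.logb,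
    Real.log_div (by positivity) (by positivity), Real.log_rpow (by positivity),
    show -2 * x * α = -2 * (α * x) by ring, add_comm (Real.exp _) 1]
  field_simp

lemma sFun_one_neg_tanh (x : ℝ) :
    sFun 1 (-Real.tanh x) = (Real.log (1 + Real.exp (-2 * x))
      + 2 * x * (Real.exp (-2 * x) / (1 + Real.exp (-2 * x)))) / Real.log 2 := by
  have hy := Real.exp_pos (-2 * x)
  have hl : Real.log 2 ≠ 0 := (Real.log_pos one_lt_two).ne'
  unfold sFun
  rw [if_pos rfl, one_add_neg_tanh_div_two, one_sub_neg_tanh_div_two, Real.logb, Real.logb,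
    Real.log_div (by positivity) (by positivity), Real.log_div (by positivity) (by positivity),
    Real.log_one, Real.log_exp]
  field_simp
  ring

lemma log_one_add_exp_nonneg (x : ℝ) : 0 ≤ Real.log (1 + Real.exp (-2 * x)) :=
  Real.log_nonneg (by linarith [Real.exp_pos (-2 * x)])

lemma log_one_add_exp_le (x : ℝ) : Real.log (1 + Real.exp (-2 * x)) ≤ Real.exp (-2 * x) := by
  have := Real.log_le_sub_one_of_pos (x := 1 + Real.exp (-2 * x))
    (by linarith [Real.exp_pos (-2 * x)])
  linarith

lemma hasDerivAt_log_one_add_exp (x : ℝ) :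
    HasDerivAt (fun x => Real.log (1 + Real.exp (-2 * x)))
      (-2 * (Real.exp (-2 * x) / (1 + Real.exp (-2 * x)))) x := by
  have h := ((((hasDerivAt_id x).const_mul (-2)).exp).const_add 1).log
    (by simp only [id]; positivity)
  convert! h using 1
  simp only [id]
  ring

lemma exp_div_one_add_exp_le (x : ℝ) :
    Real.exp (-2 * x) / (1 + Real.exp (-2 * x)) ≤ Real.exp (-2 * x) :=
  div_le_self (Real.exp_pos _).le (by linarith [Real.exp_pos (-2 * x)])

/-- Exponential decay of the derivative on a half-line gives a Lipschitz bound with decaying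
weights. -/
lemma abs_sub_le_of_deriv_exp_decay {F F' : ℝ → ℝ} {C c : ℝ} (hC : 0 ≤ C) (hc : 0 ≤ c)
    (hF : ∀ x, HasDerivAt F (F' x) x) (hF' : ∀ x, 0 ≤ x → |F' x| ≤ C * Real.exp (-c * x))
    {x y : ℝ} (hx : 0 ≤ x) (hy : 0 ≤ y) :
    |F x - F y| ≤ C * Real.exp (-c * min x y) * |x - y| := by
  wlog h : y ≤ x generalizing x y
  · rw [abs_sub_comm, min_comm, abs_sub_comm x]
    exact this hy hx (le_of_not_ge h)
  rw [min_eq_right h]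
  have := Convex.norm_image_sub_le_of_norm_hasDerivWithin_le (f := F) (f' := F')
    (C := C * Real.exp (-c * y)) (s := Set.Ici y) (x := y) (y := x)
    (fun z _ => (hF z).hasDerivWithinAt) (fun z hz => by
      have hz : y ≤ z := hz
      refine (hF' z (hy.trans hz)).trans ?_
      gcongr ?_ * Real.exp ?_
      nlinarith) (convex_Ici y) Set.self_mem_Ici h
  simpa using this

lemma abs_log_one_add_exp_sub_le {x y : ℝ} (hx : 0 ≤ x) (hy : 0 ≤ y) :
    |Real.log (1 + Real.exp (-2 * x)) - Real.log (1 + Real.exp (-2 * y))|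
      ≤ 2 * Real.exp (-2 * min x y) * |x - y| := by
  refine abs_sub_le_of_deriv_exp_decay (by norm_num) (by norm_num) hasDerivAt_log_one_add_exp
    (fun z _ => ?_) hx hy
  have h0 : 0 ≤ Real.exp (-2 * z) / (1 + Real.exp (-2 * z)) := by positivity
  rw [abs_mul, abs_of_nonneg h0, abs_neg, abs_two]
  gcongr
  exact exp_div_one_add_exp_le z

lemma exp_min_le (c x y : ℝ) :
    Real.exp (-c * min x y) ≤ Real.exp (-c * x) + Real.exp (-c * y) := by
  rcases min_choice x y with h | h <;> rw [h] <;> linarith [Real.exp_pos (-c * x),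
    Real.exp_pos (-c * y)]

lemma abs_sFun_neg_tanh_le {α : ℝ} (hα : 0 < α) (u : ℝ) :
    |sFun α (-Real.tanh u)| ≤
      (1 / Real.log 2 + 2 / Real.log 2 * |u|) * Real.exp (-2 * (min 1 α * |u|)) := by
  rw [← sFun_neg_tanh_abs]
  obtain ⟨x, hx, hxu⟩ : ∃ x, 0 ≤ x ∧ x = |u| := ⟨_, abs_nonneg u, rfl⟩
  rw [← hxu]
  have hl : 0 < Real.log 2 := Real.log_pos one_lt_two
  have hm1 : min 1 α ≤ 1 := min_le_left _ _
  have hmα : min 1 α ≤ α := min_le_right _ _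
  have hm : 0 < min 1 α := lt_min one_pos hα
  have hE : Real.exp (-2 * x) ≤ Real.exp (-2 * (min 1 α * x)) :=
    Real.exp_le_exp.mpr (by nlinarith)
  have hL := log_one_add_exp_le x
  have hL0 := log_one_add_exp_nonneg x
  rw [show (1 / Real.log 2 + 2 / Real.log 2 * x) * Real.exp (-2 * (min 1 α * x))
    = ((1 + 2 * x) * Real.exp (-2 * (min 1 α * x))) / Real.log 2 by ring]
  by_cases h1 : α = 1
  · subst h1
    rw [sFun_one_neg_tanh, abs_div, abs_of_pos hl, abs_of_nonneg (by positivity)]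
    gcongr
    have := mul_le_mul_of_nonneg_left ((exp_div_one_add_exp_le x).trans hE)
      (by positivity : 0 ≤ 2 * x)
    linarith
  · have h1' : 0 < |1 - α| := abs_pos.mpr (sub_ne_zero.mpr (Ne.symm h1))
    rw [sFun_neg_tanh_of_ne_one h1, abs_div, abs_mul, abs_of_pos hl, ← div_div]
    gcongr
    rw [div_le_iff₀ h1']
    have hd := abs_log_one_add_exp_sub_le (mul_nonneg hα.le hx) hx
    have hmin : min (α * x) x = min 1 α * x := by
      rw [min_mul_of_nonneg _ _ hx, one_mul, min_comm]
    rw [hmin, show α * x - x = -((1 - α) * x) by ring, abs_neg, abs_mul, abs_of_nonneg hx] at hd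
    calc _ = |(Real.log (1 + Real.exp (-2 * (α * x))) - Real.log (1 + Real.exp (-2 * x)))
          + (1 - α) * Real.log (1 + Real.exp (-2 * x))| := by ring_nf
      _ ≤ 2 * Real.exp (-2 * (min 1 α * x)) * (|1 - α| * x)
          + |1 - α| * Real.exp (-2 * (min 1 α * x)) := by
        refine (abs_add_le _ _).trans (add_le_add hd ?_)
        rw [abs_mul, abs_of_nonneg hL0]
        gcongr
        exact hL.trans hE
      _ = _ := by ring

lemma abs_sFun_neg_tanh_le_of_ne_one {α : ℝ} (hα : 0 < α) (h1 : α ≠ 1) (u : ℝ) :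
    |sFun α (-Real.tanh u)| ≤
      max 1 α / (|1 - α| * Real.log 2) * Real.exp (-2 * (min 1 α * |u|)) := by
  rw [← sFun_neg_tanh_abs]
  obtain ⟨x, hx, hxu⟩ : ∃ x, 0 ≤ x ∧ x = |u| := ⟨_, abs_nonneg u, rfl⟩
  rw [← hxu]
  have hl : 0 < Real.log 2 := Real.log_pos one_lt_two
  have h1' : 0 < |1 - α| := abs_pos.mpr (sub_ne_zero.mpr h1.symm)
  rw [sFun_neg_tanh_of_ne_one h1, abs_div, abs_mul, abs_of_pos hl, div_mul_eq_mul_div]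
  gcongr
  have hm1 : min 1 α ≤ 1 := min_le_left _ _
  have hmα : min 1 α ≤ α := min_le_right _ _
  have hE : Real.exp (-2 * x) ≤ Real.exp (-2 * (min 1 α * x)) :=
    Real.exp_le_exp.mpr (by nlinarith)
  have hE' : Real.exp (-2 * (α * x)) ≤ Real.exp (-2 * (min 1 α * x)) :=
    Real.exp_le_exp.mpr (by nlinarith)
  have hL := (log_one_add_exp_le x).trans hE
  have hL' := (log_one_add_exp_le (α * x)).trans hE'
  have hL0 := log_one_add_exp_nonneg x
  have hL0' := log_one_add_exp_nonneg (α * x)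
  have hp := Real.exp_pos (-2 * (min 1 α * x))
  have hA : Real.log (1 + Real.exp (-2 * (α * x)))
      ≤ max 1 α * Real.exp (-2 * (min 1 α * x)) :=
    hL'.trans (le_mul_of_one_le_left hp.le (le_max_left _ _))
  have hB : α * Real.log (1 + Real.exp (-2 * x))
      ≤ max 1 α * Real.exp (-2 * (min 1 α * x)) := by
    gcongr
    exact le_max_right _ _
  have hB0 : 0 ≤ α * Real.log (1 + Real.exp (-2 * x)) := by positivity
  rw [abs_le]
  constructor <;> linarith

lemma exists_abs_sFun_one_sub_le : ∃ C, 0 < C ∧ ∀ x y : ℝ, 0 ≤ x → 0 ≤ y →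
    |sFun 1 (-Real.tanh x) - sFun 1 (-Real.tanh y)| ≤ C * Real.exp (-1 * min x y) * |x - y| := by
  have hl : 0 < Real.log 2 := Real.log_pos one_lt_two
  refine ⟨8 / Real.log 2, by positivity, fun x y hx hy => ?_⟩
  have hd : ∀ z : ℝ, HasDerivAt (fun z => sFun 1 (-Real.tanh z))
      (2 * z * (-2 * Real.exp (-2 * z) / (1 + Real.exp (-2 * z)) ^ 2) / Real.log 2) z := by
    intro z
    have he : HasDerivAt (fun z : ℝ => Real.exp (-2 * z)) (-2 * Real.exp (-2 * z)) z := by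
      convert! ((hasDerivAt_id z).const_mul (-2)).exp using 1
      simp only [id]
      ring
    have hq := he.div (he.const_add 1) (by positivity)
    have hR := ((hasDerivAt_id z).const_mul 2).mul hq
    have := ((hasDerivAt_log_one_add_exp z).add hR).div_const (Real.log 2)
    convert! this using 1
    · funext z
      rw [sFun_one_neg_tanh]
      rfl
    · have : 1 + Real.exp (-2 * z) ≠ 0 := by positivity
      simp only [id, Pi.div_apply]
      field_simp
      ring
  refine abs_sub_le_of_deriv_exp_decay (by positivity) zero_le_one hd (fun z hz => ?_) hx hy
  have hp := Real.exp_pos (-2 * z)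
  have hs : Real.exp (-2 * z) = Real.exp (-1 * z) * Real.exp (-1 * z) := by
    rw [← Real.exp_add]; ring_nf
  have hz1 : z * Real.exp (-1 * z) ≤ 1 := by
    have h := Real.add_one_le_exp z
    have h2 : Real.exp z * Real.exp (-1 * z) = 1 := by rw [← Real.exp_add]; simp
    nlinarith [Real.exp_pos (-1 * z)]
  rw [abs_div, abs_of_pos hl, div_mul_eq_mul_div]
  gcongr
  rw [abs_mul, abs_div, abs_mul, abs_mul, abs_of_nonneg hz, abs_of_pos hp,
    abs_of_pos (by positivity : 0 < (1 + Real.exp (-2 * z)) ^ 2)]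
  have h3 : |(-2 : ℝ)| * Real.exp (-2 * z) / (1 + Real.exp (-2 * z)) ^ 2
      ≤ 2 * Real.exp (-2 * z) := by
    rw [abs_neg, abs_two]
    exact div_le_self (by positivity) (by nlinarith)
  calc _ ≤ |2| * z * (2 * Real.exp (-2 * z)) := by gcongr
    _ = 4 * (z * Real.exp (-1 * z)) * Real.exp (-1 * z) := by rw [hs, abs_two]; ring
    _ ≤ 8 * Real.exp (-1 * z) := by
      gcongr
      linarith

lemma exists_abs_sFun_neg_tanh_sub_le {α : ℝ} (hα : 0 < α) : ∃ C, 0 < C ∧ ∀ u v : ℝ,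
    |sFun α (-Real.tanh u) - sFun α (-Real.tanh v)|
      ≤ C * |u - v| * (Real.exp (-min 1 α * |u|) + Real.exp (-min 1 α * |v|)) := by
  suffices h : ∃ C, 0 < C ∧ ∀ x y : ℝ, 0 ≤ x → 0 ≤ y →
      |sFun α (-Real.tanh x) - sFun α (-Real.tanh y)|
        ≤ C * Real.exp (-min 1 α * min x y) * |x - y| by
    obtain ⟨C, hC, h⟩ := h
    refine ⟨C, hC, fun u v => ?_⟩
    rw [← sFun_neg_tanh_abs α u, ← sFun_neg_tanh_abs α v]
    calc _ ≤ C * Real.exp (-min 1 α * min |u| |v|) * |(|u| - |v|)| :=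
          h _ _ (abs_nonneg u) (abs_nonneg v)
      _ ≤ C * (Real.exp (-min 1 α * |u|) + Real.exp (-min 1 α * |v|)) * |u - v| := by
          refine mul_le_mul (mul_le_mul_of_nonneg_left (exp_min_le _ _ _) hC.le)
            (abs_abs_sub_abs_le_abs_sub u v) (abs_nonneg _) (by positivity)
      _ = _ := by ring
  by_cases h1 : α = 1
  · subst h1
    simpa using exists_abs_sFun_one_sub_le
  have hl : 0 < Real.log 2 := Real.log_pos one_lt_two
  have h1' : 0 < |1 - α| := abs_pos.mpr (sub_ne_zero.mpr (Ne.symm h1))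
  refine ⟨4 * α / (|1 - α| * Real.log 2), by positivity, fun x y hx hy => ?_⟩
  have hm1 : min 1 α ≤ 1 := min_le_left _ _
  have hmα : min 1 α ≤ α := min_le_right _ _
  have hm : 0 < min 1 α := lt_min one_pos hα
  have h0 : 0 ≤ min x y := le_min hx hy
  have hE : Real.exp (-2 * min x y) ≤ Real.exp (-min 1 α * min x y) :=
    Real.exp_le_exp.mpr (by nlinarith)
  have hE' : Real.exp (-2 * (α * min x y)) ≤ Real.exp (-min 1 α * min x y) :=
    Real.exp_le_exp.mpr (by nlinarith [mul_le_mul_of_nonneg_right hmα h0, mul_nonneg hα.le h0])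
  have hd := abs_log_one_add_exp_sub_le hx hy
  have hd' := abs_log_one_add_exp_sub_le (mul_nonneg hα.le hx) (mul_nonneg hα.le hy)
  rw [← mul_min_of_nonneg _ _ hα.le, ← mul_sub, abs_mul, abs_of_pos hα] at hd'
  rw [sFun_neg_tanh_of_ne_one h1, sFun_neg_tanh_of_ne_one h1, ← sub_div, abs_div, abs_mul,
    abs_of_pos hl, div_mul_eq_mul_div, div_mul_eq_mul_div]
  gcongr
  have e1 := hd'.trans (mul_le_mul_of_nonneg_right (mul_le_mul_of_nonneg_left hE' zero_le_two)
    (by positivity))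
  have e2 := mul_le_mul_of_nonneg_left (hd.trans (mul_le_mul_of_nonneg_right
    (mul_le_mul_of_nonneg_left hE zero_le_two) (by positivity))) hα.le
  calc _ = |(Real.log (1 + Real.exp (-2 * (α * x))) - Real.log (1 + Real.exp (-2 * (α * y))))
        - α * (Real.log (1 + Real.exp (-2 * x)) - Real.log (1 + Real.exp (-2 * y)))| := by
        ring_nf
    _ ≤ _ := by
      refine (abs_sub _ _).trans ?_
      rw [abs_mul α, abs_of_pos hα]
      linarith

lemma one_sub_tanh_mul_tanh_le {u v : ℝ} (h : u ≠ v) :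
    1 - Real.tanh u * Real.tanh v ≤ |Real.tanh u - Real.tanh v| * (1 + 1 / |u - v|) := by
  wlog huv : v < u generalizing u v
  · have := this h.symm (lt_of_le_of_ne (le_of_not_gt huv) h)
    rwa [mul_comm, abs_sub_comm, abs_sub_comm u]
  have hw : 0 < u - v := sub_pos.mpr huv
  have hx := Real.exp_pos (2 * v)
  have hy := Real.exp_pos (2 * u)
  have hexp : Real.exp (2 * v) * (2 * (u - v) + 1) ≤ Real.exp (2 * u) := by
    have : Real.exp (2 * u) = Real.exp (2 * v) * Real.exp (2 * (u - v)) := by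
      rw [← Real.exp_add]; ring_nf
    rw [this]
    gcongr
    exact Real.add_one_le_exp _
  refine le_trans ?_ (mul_le_mul_of_nonneg_right (le_abs_self _) (by positivity))
  rw [abs_of_pos hw, tanh_eq_exp_two_mul, tanh_eq_exp_two_mul, ← sub_nonneg]
  have : (Real.exp (2 * u) - 1) / (Real.exp (2 * u) + 1)
      - (Real.exp (2 * v) - 1) / (Real.exp (2 * v) + 1)
      = 2 * (Real.exp (2 * u) - Real.exp (2 * v))
        / ((Real.exp (2 * u) + 1) * (Real.exp (2 * v) + 1)) := by
    field_simp; ring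
  rw [this]
  have : 2 * (Real.exp (2 * u) - Real.exp (2 * v))
        / ((Real.exp (2 * u) + 1) * (Real.exp (2 * v) + 1)) * (1 + 1 / (u - v))
      - (1 - (Real.exp (2 * u) - 1) / (Real.exp (2 * u) + 1)
        * ((Real.exp (2 * v) - 1) / (Real.exp (2 * v) + 1)))
      = 2 * (Real.exp (2 * u) - Real.exp (2 * v) * (2 * (u - v) + 1))
        / ((Real.exp (2 * u) + 1) * (Real.exp (2 * v) + 1) * (u - v)) := by
    field_simp; ring
  rw [this]
  exact div_nonneg (by linarith) (by positivity)

lemma abs_weighted_sech_sq_sub_le {u v : ℝ} (h : u ≠ v) (p q : ℝ) :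
    |p * (1 - Real.tanh v ^ 2) - q * (1 - Real.tanh u ^ 2)| ≤
      |Real.tanh u - Real.tanh v| * (|p - q| * (1 + 1 / |u - v|) + (|p| + |q|)) := by
  have h1 := one_sub_tanh_mul_tanh_le h
  have hu := abs_tanh_lt_one u
  have hv := abs_tanh_lt_one v
  have h0 : 0 ≤ 1 - Real.tanh u * Real.tanh v := by
    have : |Real.tanh u * Real.tanh v| ≤ 1 := by
      rw [abs_mul]
      exact mul_le_one₀ hu.le (abs_nonneg _) hv.le
    linarith [le_abs_self (Real.tanh u * Real.tanh v)]
  calc _ = |(p - q) * (1 - Real.tanh u * Real.tanh v)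
        + (p * Real.tanh v + q * Real.tanh u) * (Real.tanh u - Real.tanh v)| := by ring_nf
    _ ≤ |p - q| * (|Real.tanh u - Real.tanh v| * (1 + 1 / |u - v|))
        + (|p| + |q|) * |Real.tanh u - Real.tanh v| := by
      refine (abs_add_le _ _).trans (add_le_add ?_ ?_)
      · rw [abs_mul, abs_of_nonneg h0]
        gcongr
      · rw [abs_mul]
        gcongr
        refine (abs_add_le _ _).trans (add_le_add ?_ ?_)
        · rw [abs_mul]
          exact mul_le_of_le_one_right (abs_nonneg _) hv.le
        · rw [abs_mul]
          exact mul_le_of_le_one_right (abs_nonneg _) hu.le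
    _ = _ := by ring

lemma deriv_lamXX (β a b θ : ℝ) : deriv (lamXX β a b) θ =
    β * b * (Real.sin θ * (1 - Real.tanh (β * (a / 2 + b * Real.cos θ)) ^ 2)) := by
  set u := β * (a / 2 + b * Real.cos θ) with hu
  have hc : Real.cosh u ≠ 0 := (Real.cosh_pos u).ne'
  have hcs := Real.cosh_sq u
  have ht : HasDerivAt Real.tanh (1 - Real.tanh u ^ 2) u := by
    have := (Real.hasDerivAt_sinh u).div (Real.hasDerivAt_cosh u) hc
    convert! this using 1
    · funext z
      exact Real.tanh_eq_sinh_div_cosh z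
    · rw [Real.tanh_eq_sinh_div_cosh]
      field_simp
  have hi : HasDerivAt (fun θ => β * (a / 2 + b * Real.cos θ)) (β * (b * -Real.sin θ)) θ :=
    (((Real.hasDerivAt_cos θ).const_mul b).const_add _).const_mul β
  have : HasDerivAt (lamXX β a b) (-((1 - Real.tanh u ^ 2) * (β * (b * -Real.sin θ)))) θ :=
    (HasDerivAt.comp (h₂ := Real.tanh) θ ht hi).neg
  rw [this.deriv]
  ring

/-- Regularised version of `|cot (r / 2)|`. -/
noncomputable def cutCot (δ r : ℝ) : ℝ := |Real.cos (r / 2)| / (|Real.sin (r / 2)| + δ)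

lemma cutCot_neg (δ r : ℝ) : cutCot δ (-r) = cutCot δ r := by
  simp [cutCot, neg_div]

lemma abs_integrand_le {S g e : ℝ → ℝ} {C a b β δ : ℝ} (hC : 0 < C) (hb : 0 < b) (hβ : 0 < β)
    (hδ : 0 < δ) (hS : ∀ u, |S (-Real.tanh u)| ≤ g u)
    (hL : ∀ u v, |S (-Real.tanh u) - S (-Real.tanh v)| ≤ C * |u - v| * (e u + e v))
    (hge : ∀ u, g u ≤ C * e u) {θ φ : ℝ} (hθφ : Real.cos θ ≠ Real.cos φ)
    {U G : ℝ → ℝ} (hU : ∀ t, U t = β * (a / 2 + b * Real.cos t))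
    (hG : ∀ u, G u = g u + 2 * C * β * b * δ * e u) :
    |dq S (lamXX β a b θ) (lamXX β a b φ) *
      ((deriv (lamXX β a b) φ - deriv (lamXX β a b) θ) / Real.tan ((φ - θ) / 2))| ≤
    β * b * (4 * C * e (U θ) + 2 * G (U θ) + 2 * G (U θ) * |Real.sin θ| * cutCot δ (φ - θ))
    + β * b * (4 * C * e (U φ) + 2 * G (U φ)
      + 2 * G (U φ) * |Real.sin φ| * cutCot δ (φ - θ)) := by
  have huv : U θ ≠ U φ := by
    rw [hU, hU]
    intro h
    have h := mul_left_cancel₀ hβ.ne' h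
    exact hθφ (mul_left_cancel₀ hb.ne' (add_left_cancel h))
  have hcos : Real.cos θ - Real.cos φ
      = 2 * Real.sin ((φ - θ) / 2) * Real.sin ((φ + θ) / 2) := by
    rw [Real.cos_sub_cos, add_comm θ φ, show (θ - φ) / 2 = -((φ - θ) / 2) by ring, Real.sin_neg]
    ring
  have hsin : Real.sin φ - Real.sin θ
      = 2 * Real.sin ((φ - θ) / 2) * Real.cos ((φ + θ) / 2) := Real.sin_sub_sin φ θ
  set ρ := |Real.sin ((φ - θ) / 2)| with hρ
  set κ := |Real.cos ((φ - θ) / 2)| with hκ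
  have hκ1 : κ ≤ 1 := Real.abs_cos_le_one _
  have hκ0 : 0 ≤ κ := abs_nonneg _
  have hρ0 : 0 < ρ := abs_pos.mpr fun h => hθφ (by rw [h] at hcos; linarith)
  have hsin_sub : |Real.sin φ - Real.sin θ| ≤ 2 * ρ := by
    rw [hsin, abs_mul, abs_mul, abs_two]
    exact mul_le_of_le_one_right (by positivity) (Real.abs_cos_le_one _)
  have huvρ : |U θ - U φ| ≤ 2 * β * b * ρ := by
    rw [hU, hU, show β * (a / 2 + b * Real.cos θ) - β * (a / 2 + b * Real.cos φ)
      = β * b * (Real.cos θ - Real.cos φ) by ring, hcos, abs_mul (β * b),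
      abs_of_pos (mul_pos hβ hb), abs_mul, abs_mul, abs_two]
    calc β * b * (2 * ρ * |Real.sin ((φ + θ) / 2)|) ≤ β * b * (2 * ρ * 1) := by
          gcongr
          exact Real.abs_sin_le_one _
      _ = _ := by ring
  set u := U θ with hu
  set v := U φ with hv
  have hw : 0 < |u - v| := abs_pos.mpr (sub_ne_zero.mpr huv)
  have htanh : Real.tanh u ≠ Real.tanh v := fun h => huv (Real.tanh_injective h)
  have ht : 0 < |Real.tanh u - Real.tanh v| := abs_pos.mpr (sub_ne_zero.mpr htanh)
  have hlam : lamXX β a b θ = -Real.tanh u := by rw [hu, hU]; rfl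
  have hlam' : lamXX β a b φ = -Real.tanh v := by rw [hv, hU]; rfl
  set x := |S (-Real.tanh u) - S (-Real.tanh v)| with hx
  have hx0 : 0 ≤ x := abs_nonneg _
  have hx1 : x ≤ g u + g v := (abs_sub _ _).trans (add_le_add (hS u) (hS v))
  have hx2 := hL u v
  rw [← hx] at hx2
  have hg0 : ∀ u, 0 ≤ g u := fun u => (abs_nonneg _).trans (hS u)
  have he0 : ∀ u, 0 ≤ e u := fun u => by
    have := (hg0 u).trans (hge u)
    exact nonneg_of_mul_nonneg_right this hC
  have hG0 : ∀ u, 0 ≤ G u := fun u => by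
    rw [hG]
    have := hg0 u
    have := he0 u
    positivity
  have hlhs : |dq S (lamXX β a b θ) (lamXX β a b φ) *
      ((deriv (lamXX β a b) φ - deriv (lamXX β a b) θ) / Real.tan ((φ - θ) / 2))|
      ≤ x * (β * b * ((|Real.sin φ - Real.sin θ| * (1 + 1 / |u - v|)
        + (|Real.sin φ| + |Real.sin θ|)) * (κ / ρ))) := by
    rw [dq, hlam, hlam', if_neg (by simpa using htanh), deriv_lamXX, deriv_lamXX, ← hU, ← hU,
      ← hu, ← hv, ← mul_sub, Real.tan_eq_sin_div_cos, abs_mul, abs_div, abs_div, abs_div, abs_mul,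
      ← hx, ← hρ, ← hκ, abs_of_pos (mul_pos hβ hb),
      show |-Real.tanh u - -Real.tanh v| = |Real.tanh u - Real.tanh v| by
        rw [← abs_neg]; ring_nf]
    have := abs_weighted_sech_sq_sub_le huv (Real.sin φ) (Real.sin θ)
    calc _ = x * (β * b * (|Real.sin φ * (1 - Real.tanh v ^ 2)
            - Real.sin θ * (1 - Real.tanh u ^ 2)| / |Real.tanh u - Real.tanh v| * (κ / ρ))) := by
          rw [div_div_eq_mul_div]
          ring
      _ ≤ _ := by
        gcongr
        rw [div_le_iff₀ ht]
        linarith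
  refine hlhs.trans ?_
  have hfirst : x * (|Real.sin φ - Real.sin θ| * (1 + 1 / |u - v|) * (κ / ρ))
      ≤ 4 * C * (e u + e v) := by
    have h1 : |Real.sin φ - Real.sin θ| * (κ / ρ) ≤ 2 := by
      calc _ ≤ 2 * ρ * (1 / ρ) := by gcongr
        _ = 2 := by field_simp
    have h2 : x * (1 + 1 / |u - v|) ≤ 2 * C * (e u + e v) := by
      have : x / |u - v| ≤ C * (e u + e v) := by
        rw [div_le_iff₀ hw]
        linarith
      have h3 : x * (1 + 1 / |u - v|) = x + x / |u - v| := by ring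
      linarith [hge u, hge v]
    calc _ = (x * (1 + 1 / |u - v|)) * (|Real.sin φ - Real.sin θ| * (κ / ρ)) := by ring
      _ ≤ (2 * C * (e u + e v)) * 2 := by
        refine mul_le_mul h2 h1 (by positivity) ?_
        have := he0 u
        have := he0 v
        positivity
      _ = _ := by ring
  have hcut : x * (κ / ρ) ≤ (G u + G v) * cutCot δ (φ - θ) := by
    have : x * (ρ + δ) ≤ (G u + G v) * ρ := by
      have h1 : x * ρ ≤ (g u + g v) * ρ := by gcongr
      have h2 : x * δ ≤ C * (2 * β * b * ρ) * (e u + e v) * δ := by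
        refine mul_le_mul_of_nonneg_right (hx2.trans ?_) hδ.le
        have := he0 u
        have := he0 v
        gcongr
      rw [hG, hG]
      linarith
    have : x / ρ ≤ (G u + G v) / (ρ + δ) := by
      rwa [div_le_div_iff₀ hρ0 (by positivity)]
    calc _ = κ * (x / ρ) := by ring
      _ ≤ κ * ((G u + G v) / (ρ + δ)) := by gcongr
      _ = _ := by rw [cutCot]; ring
  have hc0 : 0 ≤ cutCot δ (φ - θ) := by unfold cutCot; positivity
  have hρc : ρ * cutCot δ (φ - θ) ≤ 1 := by
    rw [cutCot, mul_div_assoc', div_le_one (by positivity)]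
    have : ρ * κ ≤ ρ := mul_le_of_le_one_right hρ0.le hκ1
    linarith
  have hs : |Real.sin φ| + |Real.sin θ| ≤ 2 * |Real.sin θ| + 2 * ρ := by
    have := abs_sub_abs_le_abs_sub (Real.sin φ) (Real.sin θ)
    linarith
  have hs' : |Real.sin φ| + |Real.sin θ| ≤ 2 * |Real.sin φ| + 2 * ρ := by
    have := abs_sub_abs_le_abs_sub (Real.sin θ) (Real.sin φ)
    rw [abs_sub_comm] at this
    linarith
  have hside : ∀ {s : ℝ} {w : ℝ}, |Real.sin φ| + |Real.sin θ| ≤ 2 * |s| + 2 * ρ →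
      G w * cutCot δ (φ - θ) * (|Real.sin φ| + |Real.sin θ|)
        ≤ 2 * G w + 2 * G w * |s| * cutCot δ (φ - θ) := by
    intro s w hsw
    have := hG0 w
    calc _ ≤ G w * cutCot δ (φ - θ) * (2 * |s| + 2 * ρ) := by gcongr
      _ = 2 * G w * (ρ * cutCot δ (φ - θ)) + 2 * G w * |s| * cutCot δ (φ - θ) := by ring
      _ ≤ 2 * G w * 1 + 2 * G w * |s| * cutCot δ (φ - θ) := by gcongr
      _ = _ := by ring
  have hsecond : x * (κ / ρ) * (|Real.sin φ| + |Real.sin θ|)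
      ≤ (2 * G u + 2 * G u * |Real.sin θ| * cutCot δ (φ - θ))
        + (2 * G v + 2 * G v * |Real.sin φ| * cutCot δ (φ - θ)) := by
    calc _ ≤ (G u + G v) * cutCot δ (φ - θ) * (|Real.sin φ| + |Real.sin θ|) := by gcongr
      _ = G u * cutCot δ (φ - θ) * (|Real.sin φ| + |Real.sin θ|)
          + G v * cutCot δ (φ - θ) * (|Real.sin φ| + |Real.sin θ|) := by ring
      _ ≤ _ := add_le_add (hside hs) (hside hs')
  calc _ = β * b * (x * (|Real.sin φ - Real.sin θ| * (1 + 1 / |u - v|) * (κ / ρ))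
        + x * (κ / ρ) * (|Real.sin φ| + |Real.sin θ|)) := by ring
    _ ≤ β * b * (4 * C * (e u + e v) + ((2 * G u + 2 * G u * |Real.sin θ| * cutCot δ (φ - θ))
        + (2 * G v + 2 * G v * |Real.sin φ| * cutCot δ (φ - θ)))) := by gcongr
    _ = _ := by ring

lemma cutCot_continuous {δ : ℝ} (hδ : 0 < δ) : Continuous (cutCot δ) := by
  unfold cutCot
  exact Continuous.div (by fun_prop) (by fun_prop) fun r => by positivity

lemma cutCot_periodic (δ : ℝ) : Function.Periodic (cutCot δ) (2 * π) := fun r => by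
  simp only [cutCot, show (r + 2 * π) / 2 = r / 2 + π by ring, Real.sin_add_pi, Real.cos_add_pi,
    abs_neg]

lemma integral_cutCot_zero_pi {δ : ℝ} (hδ : 0 < δ) :
    ∫ r in (0 : ℝ)..π, cutCot δ r = 2 * Real.log ((1 + δ) / δ) := by
  have hs : ∀ r ∈ Set.uIcc 0 π, 0 ≤ Real.sin (r / 2) := fun r hr => by
    rw [Set.uIcc_of_le Real.pi_pos.le] at hr
    exact Real.sin_nonneg_of_nonneg_of_le_pi (by linarith [hr.1]) (by linarith [hr.2, Real.pi_pos])
  have hc : ∀ r ∈ Set.uIcc 0 π, 0 ≤ Real.cos (r / 2) := fun r hr => by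
    rw [Set.uIcc_of_le Real.pi_pos.le] at hr
    exact Real.cos_nonneg_of_neg_pi_div_two_le_of_le (by linarith [hr.1, Real.pi_pos])
      (by linarith [hr.2])
  have := intervalIntegral.integral_eq_sub_of_hasDerivAt (a := 0) (b := π)
    (f := fun r => 2 * Real.log (Real.sin (r / 2) + δ)) (f' := cutCot δ) (fun r hr => by
      have h1 : Real.sin (r / 2) + δ ≠ 0 := by linarith [hs r hr]
      have h := (((((hasDerivAt_id r).div_const 2).sin).add_const δ).log h1).const_mul 2
      convert! h using 1
      simp only [cutCot, abs_of_nonneg (hs r hr), abs_of_nonneg (hc r hr), id]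
      field_simp) ((cutCot_continuous hδ).intervalIntegrable _ _)
  rw [this, Real.log_div (by positivity) hδ.ne']
  simp
  ring

lemma integral_cutCot_sub {δ : ℝ} (hδ : 0 < δ) (t : ℝ) :
    ∫ r in (-π)..π, cutCot δ (r - t) = 4 * Real.log ((1 + δ) / δ) := by
  have hi : ∀ x y, IntervalIntegrable (cutCot δ) volume x y :=
    fun x y => (cutCot_continuous hδ).intervalIntegrable _ _
  have h := (cutCot_periodic δ).intervalIntegral_add_eq (-π - t) (-π)
  rw [intervalIntegral.integral_comp_sub_right (fun r => cutCot δ r)]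
  rw [show -π - t + 2 * π = π - t by ring, show -π + 2 * π = π by ring] at h
  have hneg := intervalIntegral.integral_comp_neg (a := 0) (b := π) (cutCot δ)
  simp only [cutCot_neg, neg_zero] at hneg
  rw [h, ← intervalIntegral.integral_add_adjacent_intervals (hi (-π) 0) (hi 0 π), ← hneg,
    integral_cutCot_zero_pi hδ]
  ring

lemma integral_integral_majorant {P Q : ℝ → ℝ} (hP : Continuous P) (hQ : Continuous Q) {δ : ℝ}
    (hδ : 0 < δ) :
    ∫ φ in (-π)..π, ∫ θ in (-π)..π,
        ((P θ + Q θ * cutCot δ (φ - θ)) + (P φ + Q φ * cutCot δ (φ - θ))) =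
      4 * π * (∫ θ in (-π)..π, P θ)
        + 8 * Real.log ((1 + δ) / δ) * ∫ θ in (-π)..π, Q θ := by
  have hk := cutCot_continuous hδ
  have key : ∀ t, ∫ r in (-π)..π, (P t + Q t * cutCot δ (r - t))
      = 2 * π * P t + 4 * Real.log ((1 + δ) / δ) * Q t := fun t => by
    rw [intervalIntegral.integral_add (by simp) (Continuous.intervalIntegrable (by fun_prop) _ _),
      intervalIntegral.integral_const_mul, integral_cutCot_sub hδ]
    simp
    ring
  have key' : ∀ t, ∫ r in (-π)..π, (P t + Q t * cutCot δ (t - r))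
      = 2 * π * P t + 4 * Real.log ((1 + δ) / δ) * Q t := fun t => by
    rw [← key t]
    congr 1
    funext r
    rw [← cutCot_neg, neg_sub]
  have hF : Continuous (Function.uncurry fun φ θ => P θ + Q θ * cutCot δ (φ - θ)) := by
    unfold Function.uncurry
    fun_prop
  have hswap : ∫ φ in (-π)..π, ∫ θ in (-π)..π, (P θ + Q θ * cutCot δ (φ - θ))
      = ∫ θ in (-π)..π, ∫ φ in (-π)..π, (P θ + Q θ * cutCot δ (φ - θ)) := by
    refine MeasureTheory.intervalIntegral_intervalIntegral_swap ?_
    refine (hF.continuousOn.integrableOn_compact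
      (isCompact_uIcc.prod isCompact_uIcc)).mono_set
      (Set.prod_mono Set.uIoc_subset_uIcc Set.uIoc_subset_uIcc)
  have hinner : ∀ φ, ∫ θ in (-π)..π,
        ((P θ + Q θ * cutCot δ (φ - θ)) + (P φ + Q φ * cutCot δ (φ - θ)))
      = (∫ θ in (-π)..π, (P θ + Q θ * cutCot δ (φ - θ)))
        + (2 * π * P φ + 4 * Real.log ((1 + δ) / δ) * Q φ) := fun φ => by
    rw [← key', intervalIntegral.integral_add] <;>
      exact Continuous.intervalIntegrable (by fun_prop) _ _
  simp only [hinner]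
  rw [intervalIntegral.integral_add, hswap]
  · simp only [key]
    rw [intervalIntegral.integral_add, intervalIntegral.integral_const_mul,
      intervalIntegral.integral_const_mul]
    · ring
    all_goals exact Continuous.intervalIntegrable (by fun_prop) _ _
  · exact (intervalIntegral.continuous_parametric_intervalIntegral_of_continuous'
      (f := fun φ θ => P θ + Q θ * cutCot δ (φ - θ)) hF _ _).intervalIntegrable _ _
  · exact Continuous.intervalIntegrable (by fun_prop) _ _

lemma integral_affine_mul_exp_le {A B c : ℝ} (hA : 0 ≤ A) (hB : 0 ≤ B) (hc : 0 < c) {x y : ℝ} :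
    ∫ u in x..y, (A + B * |u|) * Real.exp (-(c * |u|)) ≤ 2 * (A / c + B / c ^ 2) := by
  set F : ℝ → ℝ := fun u => (A + B * |u|) * Real.exp (-(c * |u|)) with hF
  have hFc : Continuous F := by fun_prop
  have hhalf : ∀ {y : ℝ}, 0 ≤ y → |∫ u in (0 : ℝ)..y, F u| ≤ A / c + B / c ^ 2 := by
    intro y hy
    have hF0 : 0 ≤ ∫ u in (0 : ℝ)..y, F u :=
      intervalIntegral.integral_nonneg hy fun u _ => by positivity
    rw [abs_of_nonneg hF0]
    have := intervalIntegral.integral_eq_sub_of_hasDerivAt (a := 0) (b := y) (f' := F)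
      (f := fun u => -((A / c + B / c ^ 2 + B / c * u) * Real.exp (-(c * u)))) (fun u hu => by
        rw [Set.uIcc_of_le hy] at hu
        have h1 : HasDerivAt (fun u => Real.exp (-(c * u))) (Real.exp (-(c * u)) * (-(c * 1))) u :=
          (((hasDerivAt_id u).const_mul c).neg).exp
        have h2 : HasDerivAt (fun u => A / c + B / c ^ 2 + B / c * u) (B / c * 1) u :=
          ((hasDerivAt_id u).const_mul (B / c)).const_add _
        convert! (h2.mul h1).neg using 1
        simp only [hF, abs_of_nonneg hu.1]
        field_simp
        ring) (hFc.intervalIntegrable _ _)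
    rw [this]
    have : 0 ≤ (A / c + B / c ^ 2 + B / c * y) * Real.exp (-(c * y)) := by positivity
    simp
    linarith
  have hall : ∀ y : ℝ, |∫ u in (0 : ℝ)..y, F u| ≤ A / c + B / c ^ 2 := by
    intro y
    rcases le_total 0 y with hy | hy
    · exact hhalf hy
    · have h := intervalIntegral.integral_comp_neg (a := 0) (b := -y) F
      have hev : ∀ u, F (-u) = F u := fun u => by simp [hF]
      simp only [hev, neg_zero, neg_neg] at h
      rw [intervalIntegral.integral_symm, ← h, abs_neg]
      exact hhalf (neg_nonneg.mpr hy)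
  have hi : ∀ x y, IntervalIntegrable F volume x y := fun x y => hFc.intervalIntegrable _ _
  have := intervalIntegral.integral_add_adjacent_intervals (hi x 0) (hi 0 y)
  rw [intervalIntegral.integral_symm] at this
  have h1 := abs_le.mp (hall x)
  have h2 := abs_le.mp (hall y)
  linarith [h1.1, h2.2]

lemma integral_comp_mul_abs_sin_le {G U : ℝ → ℝ} {a b β T : ℝ} (hG : Continuous G)
    (hT : ∀ x y, ∫ u in x..y, G u ≤ T) (hU : ∀ t, U t = β * (a / 2 + b * Real.cos t)) :
    ∫ θ in (-π)..π, β * b * (G (U θ) * |Real.sin θ|) ≤ 2 * T := by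
  have hUc : Continuous U := by
    rw [funext hU]
    fun_prop
  set F : ℝ → ℝ := fun θ => β * b * (G (U θ) * |Real.sin θ|) with hF
  have hFc : Continuous F := by fun_prop
  have hhalf : ∫ θ in (0 : ℝ)..π, F θ ≤ T := by
    have hd : ∀ t, HasDerivAt U (β * (b * -Real.sin t)) t := fun t => by
      rw [funext hU]
      exact (((Real.hasDerivAt_cos t).const_mul b).const_add _).const_mul β
    have h := intervalIntegral.integral_comp_mul_deriv (a := 0) (b := π) (f := U)
      (f' := fun t => β * (b * -Real.sin t)) (g := G) (fun t _ => hd t)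
      (Continuous.continuousOn (by fun_prop)) hG
    have h2 : ∫ θ in (0 : ℝ)..π, F θ
        = -∫ θ in (0 : ℝ)..π, (G ∘ U) θ * (β * (b * -Real.sin θ)) := by
      rw [← intervalIntegral.integral_neg]
      refine intervalIntegral.integral_congr fun t ht => ?_
      rw [Set.uIcc_of_le Real.pi_pos.le] at ht
      simp only [hF, Function.comp, abs_of_nonneg (Real.sin_nonneg_of_nonneg_of_le_pi ht.1 ht.2)]
      ring
    rw [h2, h, ← intervalIntegral.integral_symm]
    exact hT _ _
  have hi : ∀ x y, IntervalIntegrable F volume x y := fun x y => hFc.intervalIntegrable _ _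
  have hneg := intervalIntegral.integral_comp_neg (a := 0) (b := π) F
  have hev : ∀ t, F (-t) = F t := fun t => by simp [hF, hU]
  simp only [hev, neg_zero] at hneg
  rw [← intervalIntegral.integral_add_adjacent_intervals (hi (-π) 0) (hi 0 π), ← hneg]
  linarith

lemma one_sub_abs_le_abs_sin_add (c t : ℝ) :
    1 - |c| ≤ |Real.sin t| + |Real.cos t - c| := by
  have h1 := Real.sin_sq_add_cos_sq t
  have h2 := Real.abs_sin_le_one t
  have h3 := Real.abs_cos_le_one t
  have h4 := abs_sub_abs_le_abs_sub (Real.cos t) c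
  rw [← sq_abs (Real.sin t), ← sq_abs (Real.cos t)] at h1
  nlinarith [abs_nonneg (Real.sin t), abs_nonneg (Real.cos t)]

/-- The thermal weight `β e(β(a/2 + b cos θ))` has bounded mass uniformly in `β`, because the
Fermi points are nondegenerate in the critical phase. -/
lemma integral_thermal_weight_le {e U : ℝ → ℝ} {a b β T D : ℝ} (he : Continuous e)
    (he0 : ∀ u, 0 ≤ e u) (hD : ∀ u, |u| * e u ≤ D) (hT : ∀ x y, ∫ u in x..y, e u ≤ T)
    (hb : 0 < b) (hβ : 0 < β) (ha : |a| < 2 * b)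
    (hU : ∀ t, U t = β * (a / 2 + b * Real.cos t)) :
    ∫ θ in (-π)..π, β * b * e (U θ) ≤ (2 * T + 2 * π * D) / (1 - |a| / (2 * b)) := by
  have hUc : Continuous U := by
    rw [funext hU]
    fun_prop
  have hgap : 0 < 1 - |a| / (2 * b) := by
    rw [sub_pos, div_lt_one (by positivity)]
    exact ha
  rw [le_div_iff₀ hgap, ← intervalIntegral.integral_mul_const]
  calc _ ≤ ∫ θ in (-π)..π, (β * b * (e (U θ) * |Real.sin θ|) + D) := by
        refine intervalIntegral.integral_mono_on (by linarith [Real.pi_pos])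
          (Continuous.intervalIntegrable (by fun_prop) _ _)
          (Continuous.intervalIntegrable (by fun_prop) _ _) fun t _ => ?_
        have hc : |(-(a / (2 * b)))| = |a| / (2 * b) := by
          rw [abs_neg, abs_div, abs_of_pos (by positivity : 0 < 2 * b)]
        have h := one_sub_abs_le_abs_sin_add (-(a / (2 * b))) t
        rw [hc] at h
        have hUt : |U t| = β * b * |Real.cos t - -(a / (2 * b))| := by
          rw [hU, ← abs_of_pos (mul_pos hβ hb), ← abs_mul]
          congr 1
          field_simp
          ring
        have hp := he0 (U t)
        calc _ ≤ β * b * e (U t) * (|Real.sin t| + |Real.cos t - -(a / (2 * b))|) := by gcongr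
          _ = β * b * (e (U t) * |Real.sin t|) + |U t| * e (U t) := by rw [hUt]; ring
          _ ≤ _ := by gcongr; exact hD _
    _ = (∫ θ in (-π)..π, β * b * (e (U θ) * |Real.sin θ|)) + 2 * π * D := by
        rw [intervalIntegral.integral_add (Continuous.intervalIntegrable (by fun_prop) _ _)
          (by simp), intervalIntegral.integral_const, smul_eq_mul]
        ring
    _ ≤ _ := by
        gcongr
        exact integral_comp_mul_abs_sin_le he hT hU

lemma ae_cos_ne_cos (φ : ℝ) : ∀ᵐ θ : ℝ, Real.cos θ ≠ Real.cos φ := by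
  have : {θ : ℝ | Real.cos θ = Real.cos φ}.Countable := by
    refine ((Set.countable_range fun k : ℤ => 2 * (k : ℝ) * π + φ).union
      (Set.countable_range fun k : ℤ => 2 * (k : ℝ) * π - φ)).mono fun θ hθ => ?_
    obtain ⟨k, hk | hk⟩ := Real.cos_eq_cos_iff.mp (Eq.symm hθ)
    · exact Or.inl ⟨k, hk.symm⟩
    · exact Or.inr ⟨k, hk.symm⟩
  filter_upwards [this.ae_notMem volume] with θ hθ using hθ

lemma limsup_div_log_le {I : ℝ → ℝ} {T E : ℝ} (hT : 0 ≤ T) (hE : 0 ≤ E)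
    (h : ∀ η > 0, ∃ K, ∀ β, 1 ≤ β → I β ≤ K + (T + η * E) * Real.log β) :
    Filter.limsup (fun β => I β / Real.log β) atTop ≤ T := by
  rw [Filter.limsup_eq]
  by_cases hbdd : BddBelow {y | ∀ᶠ β in atTop, I β / Real.log β ≤ y}
  swap
  · rwa [Real.sInf_of_not_bddBelow hbdd]
  refine le_of_forall_pos_le_add fun ε hε => csInf_le hbdd ?_
  obtain ⟨K, hK⟩ := h (ε / (2 * (E + 1))) (by positivity)
  have hηE : ε / (2 * (E + 1)) * E ≤ ε / 2 := by
    rw [div_mul_eq_mul_div, div_le_div_iff₀ (by positivity) two_pos]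
    nlinarith
  filter_upwards [Real.tendsto_log_atTop.eventually_ge_atTop (2 * |K| / ε),
    eventually_gt_atTop (1 : ℝ)] with β hβ hβ1
  have hlog : 0 < Real.log β := Real.log_pos hβ1
  rw [div_le_iff₀ hlog]
  rw [div_le_iff₀ hε] at hβ
  nlinarith [hK β hβ1.le, le_abs_self K, mul_le_mul_of_nonneg_right hηE hlog.le]

lemma abs_mul_exp_neg_le {c : ℝ} (hc : 0 < c) (u : ℝ) :
    |u| * Real.exp (-c * |u|) ≤ 1 / c := by
  have h := Real.add_one_le_exp (c * |u|)
  rw [le_div_iff₀ hc]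
  have h1 : Real.exp (c * |u|) * Real.exp (-c * |u|) = 1 := by rw [← Real.exp_add]; simp
  nlinarith [Real.exp_pos (-c * |u|)]

/-- Logarithmic growth of the double integral for an abstract entropy function with
exponentially decaying envelopes. -/
lemma abs_integral_integral_le {S g e : ℝ → ℝ} {C a b β δ T Te D : ℝ} (hg : Continuous g)
    (he : Continuous e) (hC : 0 < C) (hb : 0 < b) (hβ : 0 < β) (hδ : 0 < δ) (ha : |a| < 2 * b)
    (hS : ∀ u, |S (-Real.tanh u)| ≤ g u)
    (hL : ∀ u v, |S (-Real.tanh u) - S (-Real.tanh v)| ≤ C * |u - v| * (e u + e v))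
    (hge : ∀ u, g u ≤ C * e u) (hT : ∀ x y, ∫ u in x..y, g u ≤ T)
    (hTe : ∀ x y, ∫ u in x..y, e u ≤ Te) (hD : ∀ u, |u| * e u ≤ D) :
    |∫ φ in (-π)..π, ∫ θ in (-π)..π, dq S (lamXX β a b θ) (lamXX β a b φ) *
      ((deriv (lamXX β a b) φ - deriv (lamXX β a b) θ) / Real.tan ((φ - θ) / 2))| ≤
    4 * π * ((6 * C + 4 * C * β * b * δ) * ((2 * Te + 2 * π * D) / (1 - |a| / (2 * b))))
      + 32 * Real.log ((1 + δ) / δ) * (T + 2 * C * β * b * δ * Te) := by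
  obtain ⟨U, hU⟩ : ∃ U : ℝ → ℝ, ∀ t, U t = β * (a / 2 + b * Real.cos t) := ⟨_, fun _ => rfl⟩
  obtain ⟨G, hG⟩ : ∃ G : ℝ → ℝ, ∀ u, G u = g u + 2 * C * β * b * δ * e u := ⟨_, fun _ => rfl⟩
  have hUc : Continuous U := by rw [funext hU]; fun_prop
  have hGc : Continuous G := by rw [funext hG]; fun_prop
  have he0 : ∀ u, 0 ≤ e u := fun u =>
    nonneg_of_mul_nonneg_right (((abs_nonneg _).trans (hS u)).trans (hge u)) hC
  have hPc : Continuous fun θ => β * b * (4 * C * e (U θ) + 2 * G (U θ)) := by fun_prop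
  have hQc : Continuous fun θ => β * b * (2 * G (U θ) * |Real.sin θ|) := by fun_prop
  have hk := cutCot_continuous hδ
  have hGT : ∀ x y, ∫ u in x..y, G u ≤ T + 2 * C * β * b * δ * Te := fun x y => by
    simp only [hG]
    rw [intervalIntegral.integral_add (hg.intervalIntegrable _ _)
      (Continuous.intervalIntegrable (by fun_prop) _ _), intervalIntegral.integral_const_mul]
    have := hT x y
    have := hTe x y
    gcongr
  have hPint : ∫ θ in (-π)..π, β * b * (4 * C * e (U θ) + 2 * G (U θ))
      ≤ (6 * C + 4 * C * β * b * δ) * ((2 * Te + 2 * π * D) / (1 - |a| / (2 * b))) := by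
    calc _ ≤ ∫ θ in (-π)..π, (6 * C + 4 * C * β * b * δ) * (β * b * e (U θ)) := by
          refine intervalIntegral.integral_mono_on (by linarith [Real.pi_pos])
            (hPc.intervalIntegrable _ _)
            (Continuous.intervalIntegrable (by fun_prop) _ _) fun t _ => ?_
          have h := hge (U t)
          calc _ ≤ β * b * (4 * C * e (U t) + 2 * (C * e (U t) + 2 * C * β * b * δ * e (U t))) := by
                rw [hG]
                gcongr
            _ = _ := by ring
      _ ≤ _ := by
        rw [intervalIntegral.integral_const_mul]
        gcongr
        exact integral_thermal_weight_le he he0 hD hTe hb hβ ha hU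
  have hQint : ∫ θ in (-π)..π, β * b * (2 * G (U θ) * |Real.sin θ|)
      ≤ 4 * (T + 2 * C * β * b * δ * Te) := by
    have := integral_comp_mul_abs_sin_le hGc hGT hU
    calc _ = 2 * ∫ θ in (-π)..π, β * b * (G (U θ) * |Real.sin θ|) := by
          rw [← intervalIntegral.integral_const_mul]
          congr 1
          funext θ
          ring
      _ ≤ _ := by linarith
  have hππ : -π ≤ π := by linarith [Real.pi_pos]
  have hmaj : Continuous (Function.uncurry fun φ θ =>
      (β * b * (4 * C * e (U θ) + 2 * G (U θ))
        + β * b * (2 * G (U θ) * |Real.sin θ|) * cutCot δ (φ - θ))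
      + (β * b * (4 * C * e (U φ) + 2 * G (U φ))
        + β * b * (2 * G (U φ) * |Real.sin φ|) * cutCot δ (φ - θ))) := by
    unfold Function.uncurry
    fun_prop
  have hlog : 0 ≤ Real.log ((1 + δ) / δ) := by
    refine Real.log_nonneg ?_
    rw [one_le_div hδ]
    linarith
  have hpar : ∀ M : ℝ → ℝ → ℝ, Continuous (Function.uncurry M) →
      IntervalIntegrable (fun φ => ∫ θ in (-π)..π, M φ θ) volume (-π) π := fun M hM =>
    (intervalIntegral.continuous_parametric_intervalIntegral_of_continuous'
      hM _ _).intervalIntegrable _ _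
  calc _ ≤ ∫ φ in (-π)..π, ∫ θ in (-π)..π,
        ((β * b * (4 * C * e (U θ) + 2 * G (U θ))
          + β * b * (2 * G (U θ) * |Real.sin θ|) * cutCot δ (φ - θ))
        + (β * b * (4 * C * e (U φ) + 2 * G (U φ))
          + β * b * (2 * G (U φ) * |Real.sin φ|) * cutCot δ (φ - θ))) := by
        rw [← Real.norm_eq_abs]
        refine intervalIntegral.norm_integral_le_of_norm_le hππ (ae_of_all _ fun φ _ => ?_)
          (hpar _ hmaj)
        refine intervalIntegral.norm_integral_le_of_norm_le hππ ?_
          (Continuous.intervalIntegrable (by fun_prop) _ _)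
        filter_upwards [ae_cos_ne_cos φ] with θ hθ _
        refine (abs_integrand_le hC hb hβ hδ hS hL hge hθ hU hG).trans (le_of_eq ?_)
        ring
    _ = _ := integral_integral_majorant hPc hQc hδ
    _ ≤ 4 * π * ((6 * C + 4 * C * β * b * δ) * ((2 * Te + 2 * π * D) / (1 - |a| / (2 * b))))
        + 8 * Real.log ((1 + δ) / δ) * (4 * (T + 2 * C * β * b * δ * Te)) := by gcongr
    _ = _ := by ring

/-- An exponential envelope `(A + B|u|) e^{-2 min{1,α} |u|}` for the entropy function controls the
logarithmic growth rate of the mutual information. -/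
lemma limsup_IalphaInf_le {a b α A B : ℝ} (hb : 0 < b) (ha : |a| < 2 * b) (hα : 0 < α)
    (hA : 0 ≤ A) (hB : 0 ≤ B)
    (hS : ∀ u, |sFun α (-Real.tanh u)| ≤
      (A + B * |u|) * Real.exp (-2 * (min 1 α * |u|))) :
    Filter.limsup (fun β : ℝ => IalphaInf α a b β / Real.log β) atTop ≤
      8 / π ^ 2 * (A / min 1 α + B / (2 * min 1 α ^ 2)) := by
  have hπ := Real.pi_pos
  have hm : 0 < min 1 α := lt_min one_pos hα
  set m := min 1 α with hmdef
  set T := A / m + B / (2 * m ^ 2) with hTdef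
  have hT0 : 0 ≤ T := by positivity
  obtain ⟨C₀, hC₀, hL⟩ := exists_abs_sFun_neg_tanh_sub_le hα
  obtain ⟨C, hC⟩ : ∃ C, C = C₀ + A + B / m := ⟨_, rfl⟩
  have hCpos : 0 < C := by rw [hC]; positivity
  have hCC₀ : C₀ ≤ C := by
    have : 0 ≤ B / m := by positivity
    linarith
  have hTg : ∀ x y, ∫ u in x..y, (A + B * |u|) * Real.exp (-2 * (m * |u|)) ≤ T := fun x y => by
    have := integral_affine_mul_exp_le hA hB (by positivity : 0 < 2 * m) (x := x) (y := y)
    calc _ = ∫ u in x..y, (A + B * |u|) * Real.exp (-(2 * m * |u|)) := by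
          congr 1
          funext u
          ring_nf
      _ ≤ _ := this
      _ = T := by
        rw [hTdef]
        field_simp
  have hTe : ∀ x y, ∫ u in x..y, Real.exp (-m * |u|) ≤ 2 / m := fun x y => by
    have := integral_affine_mul_exp_le zero_le_one le_rfl hm (x := x) (y := y)
    simp only [zero_mul, add_zero, one_mul, zero_div] at this
    calc _ = ∫ u in x..y, Real.exp (-(m * |u|)) := by simp only [neg_mul]
      _ ≤ _ := this
      _ = _ := by ring
  have hge : ∀ u, (A + B * |u|) * Real.exp (-2 * (m * |u|)) ≤ C * Real.exp (-m * |u|) := by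
    intro u
    have h1 := abs_mul_exp_neg_le hm u
    have h2 : Real.exp (-2 * (m * |u|)) = Real.exp (-m * |u|) * Real.exp (-m * |u|) := by
      rw [← Real.exp_add]; ring_nf
    have h3 : Real.exp (-m * |u|) ≤ 1 := Real.exp_le_one_iff.mpr (by
      have := mul_nonneg hm.le (abs_nonneg u)
      linarith)
    calc _ = (A * Real.exp (-m * |u|) + B * (|u| * Real.exp (-m * |u|)))
          * Real.exp (-m * |u|) := by rw [h2]; ring
      _ ≤ (A * 1 + B * (1 / m)) * Real.exp (-m * |u|) := by gcongr
      _ ≤ _ := by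
        gcongr
        rw [hC, mul_one, mul_one_div]
        linarith
  refine limsup_div_log_le (E := 8 / π ^ 2 * (2 / m)) (by positivity) (by positivity)
    fun η hη => ?_
  set R := (2 * (2 / m) + 2 * π * (1 / m)) / (1 - |a| / (2 * b)) with hR
  refine ⟨(4 * π * ((6 * C + 2 * η) * R)) / (4 * π ^ 2)
    + 8 / π ^ 2 * (T + η * (2 / m)) * Real.log (1 + 2 * C * b / η), fun β hβ1 => ?_⟩
  have hβ : 0 < β := by linarith
  obtain ⟨δ, hδ⟩ : ∃ δ, δ = η / (2 * C * β * b) := ⟨_, rfl⟩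
  have hδpos : 0 < δ := by rw [hδ]; positivity
  have hηδ : 2 * C * β * b * δ = η := by rw [hδ]; field_simp
  have hJ := abs_integral_integral_le (S := sFun α) (C := C) (a := a) (β := β)
    (g := fun u => (A + B * |u|) * Real.exp (-2 * (m * |u|)))
    (e := fun u => Real.exp (-m * |u|)) (D := 1 / m)
    (by fun_prop) (by fun_prop) hCpos hb hβ hδpos ha hS
    (fun u v => (hL u v).trans (by rw [← hmdef]; gcongr)) hge hTg hTe (abs_mul_exp_neg_le hm)
  rw [← hR, hηδ, show 4 * C * β * b * δ = 2 * (2 * C * β * b * δ) by ring, hηδ] at hJ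
  have hlog : Real.log ((1 + δ) / δ) ≤ Real.log (1 + 2 * C * b / η) + Real.log β := by
    rw [← Real.log_mul (by positivity) hβ.ne']
    refine Real.log_le_log (by positivity) ?_
    have : (1 + δ) / δ = 1 + 2 * C * b / η * β := by rw [hδ]; field_simp; ring
    rw [this]
    linarith
  rw [IalphaInf]
  calc _ ≤ 1 / (4 * π ^ 2) * (4 * π * ((6 * C + 2 * η) * R)
        + 32 * (Real.log (1 + 2 * C * b / η) + Real.log β) * (T + η * (2 / m))) := by
        gcongr
        refine ((le_abs_self _).trans hJ).trans ?_
        gcongr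
    _ = _ := by
      field_simp
      ring

/-- **Low-temperature asymptotics in the critical phase `|a| < 2b`** (Theorem 4, Eq. (50)):
the mutual information grows at most logarithmically in `β`, with the explicit constant
`(2α/(π² log 2 (min{1,α})²))·min{27/(2 min{1,α}), 4/|1-α|}` (for `α = 1` the minimum is
understood to be its first argument `27/(2 min{1,α})`). -/
theorem xx_low_temperature_critical (a b α : ℝ) (hb : 0 < b) (ha : |a| < 2 * b)
    (hα : 0 < α) :
    Filter.limsup (fun β : ℝ => IalphaInf α a b β / Real.log β) atTop ≤
      (2 * α / (π ^ 2 * Real.log 2 * (min 1 α) ^ 2)) *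
        (if α = 1 then 27 / (2 * min 1 α)
          else min (27 / (2 * min 1 α)) (4 / |1 - α|)) := by
  have hπ := Real.pi_pos
  have hm : 0 < min 1 α := lt_min one_pos hα
  have hm1 : min 1 α ≤ 1 := min_le_left _ _
  have hmα : min 1 α ≤ α := min_le_right _ _
  have hl : 0 < Real.log 2 := Real.log_pos one_lt_two
  have huniform : Filter.limsup (fun β : ℝ => IalphaInf α a b β / Real.log β) atTop ≤
      (2 * α / (π ^ 2 * Real.log 2 * (min 1 α) ^ 2)) * (27 / (2 * min 1 α)) := by
    refine (limsup_IalphaInf_le hb ha hα (by positivity) (by positivity)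
      (abs_sFun_neg_tanh_le hα)).trans ?_
    set m := min 1 α
    have h1 : 8 / π ^ 2 * (1 / Real.log 2 / m + 2 / Real.log 2 / (2 * m ^ 2))
        = (8 * (m * m + m)) / (π ^ 2 * Real.log 2 * m ^ 3) := by field_simp
    have h2 : 2 * α / (π ^ 2 * Real.log 2 * m ^ 2) * (27 / (2 * m))
        = (27 * α) / (π ^ 2 * Real.log 2 * m ^ 3) := by field_simp
    rw [h1, h2]
    gcongr ?_ / _
    nlinarith
  split_ifs with h1
  · exact huniform
  rw [mul_min_of_nonneg _ _ (by positivity)]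
  refine le_min huniform ?_
  have h1' : 0 < |1 - α| := abs_pos.mpr (sub_ne_zero.mpr (Ne.symm h1))
  refine (limsup_IalphaInf_le (A := max 1 α / (|1 - α| * Real.log 2)) (B := 0) hb ha hα
    (by positivity) le_rfl
    (by simpa using abs_sFun_neg_tanh_le_of_ne_one hα h1)).trans (le_of_eq ?_)
  have hmm : min 1 α * max 1 α = α := by rw [min_mul_max, one_mul]
  have hgoal : 2 * α / (π ^ 2 * Real.log 2 * min 1 α ^ 2) * (4 / |1 - α|)
      = 2 * (min 1 α * max 1 α) / (π ^ 2 * Real.log 2 * min 1 α ^ 2) * (4 / |1 - α|) := by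
    rw [hmm]
  rw [hgoal]
  field_simp
  ring
end

section
/- Let X be an n×n complex Hermitian matrix with all eigenvalues in [−1,1], partitioned in blocks X = [[X_A, X_{AB}],[X_{BA}, X_B]] with X_A of size n_A×n_A and X_B of size n_B×n_B (n_A + n_B = n), and let P = X_A ⊕ X_B be the pinching of X. Then tr s(P) − tr s(X) ≥ tr l(P) − tr l(X), where l(x) = (1 − x²)/2. Moreover the lower bound is additive: tr l(P) = tr l(X_A) + tr l(X_B). -/
open Real
open scoped Classical

/-- The covariance von-Neumann entropy function `s` on `[-1,1]`. -/
noncomputable def sVN (x : ℝ) : ℝ :=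
  -(((1 + x) / 2) * Real.logb 2 ((1 + x) / 2)) - ((1 - x) / 2) * Real.logb 2 ((1 - x) / 2)

/-- Sum of `g` over the eigenvalues of a Hermitian complex matrix (junk value `0` otherwise). -/
noncomputable def trEigC {ι : Type} [Fintype ι] [DecidableEq ι] (g : ℝ → ℝ)
    (Y : Matrix ι ι ℂ) : ℝ :=
  if hY : Y.IsHermitian then ∑ i, g (hY.eigenvalues i) else 0

/-- The quadratic lower-bound function `l(x) = (1 - x²)/2`. -/
noncomputable def lFun (x : ℝ) : ℝ := (1 - x ^ 2) / 2

theorem unitary_row_normSq_sum {ι : Type} [Fintype ι] [DecidableEq ι] {M : Matrix ι ι ℂ}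
    (h : M * star M = 1) (j : ι) : ∑ i, Complex.normSq (M j i) = 1 := by
  have h1 := congrFun (congrFun h j) j
  rw [Matrix.mul_apply, Matrix.one_apply_eq] at h1
  simp only [Matrix.star_apply, Complex.star_def, Complex.mul_conj] at h1
  exact_mod_cast h1

theorem unitary_col_normSq_sum {ι : Type} [Fintype ι] [DecidableEq ι] {M : Matrix ι ι ℂ}
    (h : star M * M = 1) (i : ι) : ∑ j, Complex.normSq (M j i) = 1 := by
  have h1 := congrFun (congrFun h i) i
  rw [Matrix.mul_apply, Matrix.one_apply_eq] at h1
  simp only [Matrix.star_apply, Complex.star_def, mul_comm _ (M _ i), Complex.mul_conj] at h1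
  exact_mod_cast h1

theorem conj_diagonal_apply_self {ι : Type} [Fintype ι] [DecidableEq ι] (M : Matrix ι ι ℂ)
    (d : ι → ℝ) (j : ι) :
    (M * Matrix.diagonal (fun i => (d i : ℂ)) * star M) j j =
      ((∑ i, Complex.normSq (M j i) * d i : ℝ) : ℂ) := by
  rw [Matrix.mul_apply]
  push_cast
  refine Finset.sum_congr rfl fun i _ => ?_
  rw [Matrix.mul_diagonal, Matrix.star_apply, Complex.star_def, ← Complex.mul_conj]
  ring

theorem hermitian_eq_conj_diagonal {ι : Type} [Fintype ι] [DecidableEq ι] {X : Matrix ι ι ℂ}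
    (hX : X.IsHermitian) :
    X = (hX.eigenvectorUnitary : Matrix ι ι ℂ) *
      Matrix.diagonal (fun i => (hX.eigenvalues i : ℂ)) *
        star (hX.eigenvectorUnitary : Matrix ι ι ℂ) := by
  have h := hX.spectral_theorem
  rw [Unitary.conjStarAlgAut_apply] at h
  exact h

/-- The trace of a concave function does not decrease when a Hermitian matrix is averaged with a
unitary conjugate of itself. -/
theorem sum_eigenvalues_le_of_average {ι : Type} [Fintype ι] [DecidableEq ι]
    {X Y U : Matrix ι ι ℂ} (hX : X.IsHermitian) (hY : Y.IsHermitian)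
    (hU : U ∈ Matrix.unitaryGroup ι ℂ) (hXY : (2 : ℂ) • Y = X + U * X * star U)
    {S : Set ℝ} {f : ℝ → ℝ} (hf : ConcaveOn ℝ S f) (hS : ∀ i, hX.eigenvalues i ∈ S) :
    ∑ i, f (hX.eigenvalues i) ≤ ∑ i, f (hY.eigenvalues i) := by
  set V := hX.eigenvectorUnitary
  set W := hY.eigenvectorUnitary
  set M : Matrix.unitaryGroup ι ℂ := star W * V with hM
  set N : Matrix.unitaryGroup ι ℂ := star W * ⟨U, hU⟩ * V with hN
  have hMW : star (W : Matrix ι ι ℂ) * X * W =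
      M.1 * Matrix.diagonal (fun i => (hX.eigenvalues i : ℂ)) * star M.1 := by
    conv_lhs => rw [hermitian_eq_conj_diagonal hX]
    simp [hM, V, W, mul_assoc]
  have hNW : star (W : Matrix ι ι ℂ) * (U * X * star U) * W =
      N.1 * Matrix.diagonal (fun i => (hX.eigenvalues i : ℂ)) * star N.1 := by
    conv_lhs => rw [hermitian_eq_conj_diagonal hX]
    simp [hN, V, W, mul_assoc]
  have hYW : star (W : Matrix ι ι ℂ) * Y * W =
      Matrix.diagonal (fun i => (hY.eigenvalues i : ℂ)) := by
    have h := hY.conjStarAlgAut_star_eigenvectorUnitary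
    rw [Unitary.conjStarAlgAut_apply] at h
    simpa [W, Function.comp_def] using h
  have hev (j : ι) : hY.eigenvalues j =
      ∑ i, ((Complex.normSq (M.1 j i) + Complex.normSq (N.1 j i)) / 2) * hX.eigenvalues i := by
    have h : (2 : ℂ) • (star (W : Matrix ι ι ℂ) * Y * W) =
        star (W : Matrix ι ι ℂ) * X * W + star (W : Matrix ι ι ℂ) * (U * X * star U) * W := by
      rw [← add_mul, ← mul_add, ← hXY]
      simp
    rw [hMW, hNW, hYW] at h
    have h1 := congrFun (congrFun h j) j
    rw [Matrix.add_apply, conj_diagonal_apply_self, conj_diagonal_apply_self, Matrix.smul_apply,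
      Matrix.diagonal_apply_eq, smul_eq_mul] at h1
    have h2 : 2 * hY.eigenvalues j = ∑ i, Complex.normSq (M.1 j i) * hX.eigenvalues i +
        ∑ i, Complex.normSq (N.1 j i) * hX.eigenvalues i := by exact_mod_cast h1
    rw [← Finset.sum_add_distrib] at h2
    rw [eq_comm, ← mul_right_inj' (two_ne_zero' ℝ), h2, Finset.mul_sum]
    exact Finset.sum_congr rfl fun i _ => by ring
  calc ∑ i, f (hX.eigenvalues i)
      = ∑ j, ∑ i, ((Complex.normSq (M.1 j i) + Complex.normSq (N.1 j i)) / 2) •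
          f (hX.eigenvalues i) := by
        rw [Finset.sum_comm]
        refine Finset.sum_congr rfl fun i _ => ?_
        rw [← Finset.sum_smul, ← Finset.sum_div, Finset.sum_add_distrib,
          unitary_col_normSq_sum (Unitary.star_mul_self_of_mem M.2),
          unitary_col_normSq_sum (Unitary.star_mul_self_of_mem N.2)]
        norm_num
    _ ≤ ∑ j, f (hY.eigenvalues j) := by
        refine Finset.sum_le_sum fun j _ => ?_
        rw [hev j]
        refine hf.le_map_sum (fun i _ => ?_) ?_ (fun i _ => hS i)
        · have := Complex.normSq_nonneg (M.1 j i)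
          have := Complex.normSq_nonneg (N.1 j i)
          positivity
        · rw [← Finset.sum_div, Finset.sum_add_distrib,
            unitary_row_normSq_sum (Unitary.mul_star_self_of_mem M.2),
            unitary_row_normSq_sum (Unitary.mul_star_self_of_mem N.2)]
          norm_num

theorem concaveOn_binEntropy_sub_quadratic :
    ConcaveOn ℝ (Set.Icc 0 1) fun p => binEntropy p / Real.log 2 - 2 * p * (1 - p) := by
  have hlog : 0 < Real.log 2 := Real.log_pos one_lt_two
  refine concaveOn_of_hasDerivWithinAt2_nonpos (convex_Icc 0 1)
    (f' := fun p => (Real.log (1 - p) - Real.log p) / Real.log 2 - (2 - 4 * p))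
    (f'' := fun p => (-1 / (1 - p) - 1 / p) / Real.log 2 + 4) (by fun_prop) ?_ ?_ ?_ <;>
    rw [interior_Icc] <;> rintro p ⟨h0, h1⟩
  · have hq : HasDerivAt (fun p : ℝ => 2 * p * (1 - p)) (2 - 4 * p) p :=
      (((hasDerivAt_id p).const_mul 2).mul ((hasDerivAt_id p).const_sub 1)).congr_deriv
        (by simp only [id]; ring)
    exact (((hasDerivAt_binEntropy h0.ne' h1.ne).div_const _).sub hq).hasDerivWithinAt
  · have hp : HasDerivAt (fun p : ℝ => Real.log (1 - p)) (-1 / (1 - p)) p :=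
      ((hasDerivAt_id p).const_sub 1).log (sub_pos.2 h1).ne'
    have hp' : HasDerivAt (fun p : ℝ => Real.log p) (1 / p) p := (hasDerivAt_id p).log h0.ne'
    have hq : HasDerivAt (fun p : ℝ => 2 - 4 * p) (-4) p :=
      (((hasDerivAt_id p).const_mul 4).const_sub 2).congr_deriv (by norm_num)
    exact ((((hp.sub hp').div_const (Real.log 2)).sub hq).congr_deriv (by ring)).hasDerivWithinAt
  · have h1p : 0 < 1 - p := sub_pos.2 h1
    have hlt : Real.log 2 < 1 := Real.log_two_lt_d9.trans (by norm_num)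
    have hpp : 4 ≤ 1 / (1 - p) + 1 / p := by
      rw [div_add_div _ _ h1p.ne' h0.ne', le_div_iff₀ (by positivity)]
      nlinarith [sq_nonneg (2 * p - 1)]
    have hdiv : 4 ≤ (1 / (1 - p) + 1 / p) / Real.log 2 := by
      rw [le_div_iff₀ hlog]
      linarith
    have heq : (-1 / (1 - p) - 1 / p) / Real.log 2 = -((1 / (1 - p) + 1 / p) / Real.log 2) := by
      ring
    change (-1 / (1 - p) - 1 / p) / Real.log 2 + 4 ≤ 0
    linarith

theorem concaveOn_sVN_sub_lFun : ConcaveOn ℝ (Set.Icc (-1) 1) fun x => sVN x - lFun x := by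
  have heq (x : ℝ) : sVN x - lFun x =
      binEntropy ((1 + x) / 2) / Real.log 2 - 2 * ((1 + x) / 2) * (1 - (1 + x) / 2) := by
    rw [sVN, lFun, binEntropy, Real.log_inv, Real.log_inv, Real.logb, Real.logb,
      show 1 - (1 + x) / 2 = (1 - x) / 2 by ring]
    ring
  simp only [heq]
  refine ⟨convex_Icc _ _, fun x hx y hy a b ha hb hab => ?_⟩
  have hmem {z : ℝ} (hz : z ∈ Set.Icc (-1 : ℝ) 1) : (1 + z) / 2 ∈ Set.Icc (0 : ℝ) 1 :=
    ⟨by linarith [hz.1], by linarith [hz.2]⟩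
  have h := concaveOn_binEntropy_sub_quadratic.2 (hmem hx) (hmem hy) ha hb hab
  have hcomb : a • ((1 + x) / 2) + b • ((1 + y) / 2) = (1 + (a • x + b • y)) / 2 := by
    simp only [smul_eq_mul]
    linear_combination hab / 2
  rwa [hcomb] at h

theorem sum_eigenvalues_sq {ι : Type} [Fintype ι] [DecidableEq ι] {Y : Matrix ι ι ℂ}
    (hY : Y.IsHermitian) : ((∑ i, hY.eigenvalues i ^ 2 : ℝ) : ℂ) = (Y * Y).trace := by
  conv_rhs => rw [hermitian_eq_conj_diagonal hY]
  set W := hY.eigenvectorUnitary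
  have h : (W.1 * Matrix.diagonal (fun i => (hY.eigenvalues i : ℂ)) * star W.1) *
      (W.1 * Matrix.diagonal (fun i => (hY.eigenvalues i : ℂ)) * star W.1) =
      W.1 * (Matrix.diagonal (fun i => (hY.eigenvalues i : ℂ)) *
        Matrix.diagonal (fun i => (hY.eigenvalues i : ℂ))) * star W.1 := by
    rw [show ∀ a b c : Matrix ι ι ℂ, (a * b * c) * (a * b * c) = a * (b * (c * a) * b) * c from
      fun a b c => by simp only [mul_assoc], Unitary.star_mul_self_of_mem W.2, mul_one]
  rw [h, Matrix.trace_mul_comm, ← mul_assoc, Unitary.star_mul_self_of_mem W.2, one_mul,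
    Matrix.diagonal_mul_diagonal, Matrix.trace_diagonal]
  push_cast
  exact Finset.sum_congr rfl fun i _ => sq _

theorem trEigC_lFun {ι : Type} [Fintype ι] [DecidableEq ι] {Y : Matrix ι ι ℂ}
    (hY : Y.IsHermitian) : trEigC lFun Y = (Fintype.card ι - (Y * Y).trace.re) / 2 := by
  rw [trEigC, dif_pos hY, ← sum_eigenvalues_sq hY, Complex.ofReal_re]
  simp only [lFun]
  rw [← Finset.sum_div, Finset.sum_sub_distrib]
  simp

/-- **Lower bound to the mutual information** (Lemma 9): for a Hermitian matrix `X` with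
spectrum in `[-1,1]` and its pinching `P = X_A ⊕ X_B`, one has
`tr s(P) - tr s(X) ≥ tr l(P) - tr l(X)`, and the lower bound is additive. -/
theorem mutual_information_lower_bound (nA nB : ℕ)
    (X : Matrix (Fin nA ⊕ Fin nB) (Fin nA ⊕ Fin nB) ℂ)
    (hX : X.IsHermitian) (hspec : ∀ i, hX.eigenvalues i ∈ Set.Icc (-1 : ℝ) 1) :
    trEigC sVN (Matrix.fromBlocks X.toBlocks₁₁ 0 0 X.toBlocks₂₂) - trEigC sVN X ≥
      trEigC lFun (Matrix.fromBlocks X.toBlocks₁₁ 0 0 X.toBlocks₂₂) - trEigC lFun X ∧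
    trEigC lFun (Matrix.fromBlocks X.toBlocks₁₁ 0 0 X.toBlocks₂₂) =
      trEigC lFun X.toBlocks₁₁ + trEigC lFun X.toBlocks₂₂ := by
  have hA : X.toBlocks₁₁.IsHermitian := hX.submatrix Sum.inl
  have hB : X.toBlocks₂₂.IsHermitian := hX.submatrix Sum.inr
  have hP : (Matrix.fromBlocks X.toBlocks₁₁ 0 0 X.toBlocks₂₂).IsHermitian :=
    hA.fromBlocks (by simp) hB
  constructor
  · have hstar : star (Matrix.fromBlocks 1 0 0 (-1) :
        Matrix (Fin nA ⊕ Fin nB) (Fin nA ⊕ Fin nB) ℂ) = Matrix.fromBlocks 1 0 0 (-1) := by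
      simp [Matrix.star_eq_conjTranspose, Matrix.fromBlocks_conjTranspose]
    have hU : (Matrix.fromBlocks 1 0 0 (-1) : Matrix (Fin nA ⊕ Fin nB) (Fin nA ⊕ Fin nB) ℂ) ∈
        Matrix.unitaryGroup (Fin nA ⊕ Fin nB) ℂ := by
      rw [Matrix.mem_unitaryGroup_iff, hstar]
      simp [Matrix.fromBlocks_multiply]
    have hPX : (2 : ℂ) • Matrix.fromBlocks X.toBlocks₁₁ 0 0 X.toBlocks₂₂ =
        X + Matrix.fromBlocks 1 0 0 (-1) * X * star (Matrix.fromBlocks 1 0 0 (-1)) := by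
      rw [hstar]
      conv_rhs => rw [← Matrix.fromBlocks_toBlocks X]
      simp [Matrix.fromBlocks_multiply, Matrix.fromBlocks_add, two_smul]
    have h := sum_eigenvalues_le_of_average hX hP hU hPX concaveOn_sVN_sub_lFun hspec
    simp only [Finset.sum_sub_distrib] at h
    simp only [trEigC, dif_pos hX, dif_pos hP]
    linarith
  · rw [trEigC_lFun hP, trEigC_lFun hA, trEigC_lFun hB, Matrix.fromBlocks_multiply]
    simp [Matrix.trace, Fintype.sum_sum_type]
    ring
end

section
/- Let X be an n×n complex Hermitian matrix with all eigenvalues in [−1,1], partitioned in blocks X = [[X_A, X_{AB}],[X_{BA}, X_B]] with X_A of size n_A×n_A and X_B of size n_B×n_B (n_A + n_B = n), and let P = X_A ⊕ X_B be the pinching of X. Then tr s(P) − tr s(X) ≤ tr u(P) − tr u(X), where u(x) = (1 − x²)^{1/2}/log 2. Moreover the upper bound is additive: tr u(P) = tr u(X_A) + tr u(X_B). -/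
open Real
open scoped Classical

/-- The upper-bound function `u(x) = √(1 - x²)/log 2`. -/
noncomputable def uFun (x : ℝ) : ℝ := Real.sqrt (1 - x ^ 2) / Real.log 2

theorem convexOn_binEntropy_sub_sqrt :
    ConvexOn ℝ (Set.Icc (-1) 1) fun x : ℝ ↦ binEntropy ((1 + x) / 2) - √(1 - x ^ 2) := by
  have hint : ∀ x ∈ interior (Set.Icc (-1 : ℝ) 1), 0 < 1 + x ∧ 0 < 1 - x ∧ 0 < 1 - x ^ 2 := by
    intro x hx
    rw [interior_Icc] at hx
    have h₁ : 0 < 1 + x := by linarith [hx.1]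
    have h₂ : 0 < 1 - x := by linarith [hx.2]
    exact ⟨h₁, h₂, by nlinarith⟩
  have hsqrt (x : ℝ) (hx : 0 < 1 - x ^ 2) :
      HasDerivAt (fun y : ℝ ↦ √(1 - y ^ 2)) (-x / √(1 - x ^ 2)) x := by
    refine (((hasDerivAt_pow 2 x).const_sub 1).sqrt hx.ne').congr_deriv ?_
    have hs := Real.sqrt_pos.2 hx
    field_simp
    simp
  refine convexOn_of_hasDerivWithinAt2_nonneg (convex_Icc _ _)
    (f' := fun x ↦ (log (1 - x) - log (1 + x)) / 2 + x / √(1 - x ^ 2))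
    (f'' := fun x ↦ -1 / (1 - x ^ 2) + 1 / (√(1 - x ^ 2) * (1 - x ^ 2)))
    (by fun_prop) ?_ ?_ ?_
  · intro x hx
    obtain ⟨h₁, h₂, h₃⟩ := hint x hx
    have hs := Real.sqrt_pos.2 h₃
    have hlin : HasDerivAt (fun x : ℝ ↦ (1 + x) / 2) (1 / 2) x :=
      ((hasDerivAt_id x).const_add 1).div_const 2
    have hb := (hasDerivAt_binEntropy (p := (1 + x) / 2) (by linarith) (by linarith)).comp x hlin
    have hq := hsqrt x h₃
    refine ((hb.sub hq).congr_deriv ?_).hasDerivWithinAt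
    have e : 1 - (1 + x) / 2 = (1 - x) / 2 := by ring
    rw [e, log_div h₂.ne' two_ne_zero, log_div h₁.ne' two_ne_zero]
    field_simp
    ring
  · intro x hx
    obtain ⟨h₁, h₂, h₃⟩ := hint x hx
    have hs := Real.sqrt_pos.2 h₃
    have hl₁ := ((hasDerivAt_id x).const_sub 1).log h₂.ne'
    have hl₂ := ((hasDerivAt_id x).const_add 1).log h₁.ne'
    have hq := hsqrt x h₃
    refine ((((hl₁.sub hl₂).div_const 2).add
      ((hasDerivAt_id x).div hq hs.ne')).congr_deriv ?_).hasDerivWithinAt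
    simp only [id]
    have hsq := Real.sq_sqrt h₃.le
    have e : (1 - x) * (1 + x) = 1 - x ^ 2 := by ring
    have e₁ : (-1 / (1 - x) - 1 / (1 + x)) / 2 = -1 / (1 - x ^ 2) := by
      rw [← e]; field_simp; ring
    rw [e₁, hsq]
    congr 1
    field_simp
    rw [hsq]
    ring
  · intro x hx
    obtain ⟨h₁, h₂, h₃⟩ := hint x hx
    have hs := Real.sqrt_pos.2 h₃
    have hs₁ : √(1 - x ^ 2) ≤ 1 := Real.sqrt_le_one.2 (by nlinarith [sq_nonneg x])
    have : -1 / (1 - x ^ 2) + 1 / (√(1 - x ^ 2) * (1 - x ^ 2)) =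
        (1 - √(1 - x ^ 2)) / (√(1 - x ^ 2) * (1 - x ^ 2)) := by
      field_simp
      ring
    rw [this]
    exact div_nonneg (by linarith) (by positivity)

theorem sVN_eq_binEntropy_div (x : ℝ) : sVN x = binEntropy ((1 + x) / 2) / log 2 := by
  have e : 1 - (1 + x) / 2 = (1 - x) / 2 := by ring
  rw [binEntropy_eq_negMulLog_add_negMulLog_one_sub, e]
  simp only [sVN, negMulLog, Real.logb]
  ring

theorem convexOn_sVN_sub_uFun : ConvexOn ℝ (Set.Icc (-1) 1) fun x ↦ sVN x - uFun x := by
  refine (convexOn_binEntropy_sub_sqrt.smul (c := (log 2)⁻¹) (by positivity)).congr fun x _ ↦ ?_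
  simp only [sVN_eq_binEntropy_div, uFun, smul_eq_mul]
  ring

namespace Matrix

variable {n : Type*} [Fintype n] [DecidableEq n]

theorem sum_normSq_row_of_mem_unitaryGroup {U : Matrix n n ℂ} (hU : U ∈ unitaryGroup n ℂ)
    (j : n) : ∑ i, Complex.normSq (U j i) = 1 := by
  have h := congrFun₂ (mem_unitaryGroup_iff.1 hU) j j
  simp only [mul_apply, star_apply, one_apply_eq, Complex.star_def, Complex.mul_conj] at h
  exact_mod_cast h

theorem sum_normSq_col_of_mem_unitaryGroup {U : Matrix n n ℂ} (hU : U ∈ unitaryGroup n ℂ)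
    (i : n) : ∑ j, Complex.normSq (U j i) = 1 := by
  have h := congrFun₂ (mem_unitaryGroup_iff'.1 hU) i i
  simp only [mul_apply, star_apply, one_apply_eq, Complex.star_def,
    ← Complex.normSq_eq_conj_mul_self] at h
  exact_mod_cast h

namespace IsHermitian

/-- The diagonal of a Hermitian matrix in any orthonormal basis is the image of its eigenvalues
under a doubly stochastic matrix. -/
theorem exists_unitary_star_mul_mul_apply_self {X : Matrix n n ℂ} (hX : X.IsHermitian)
    {V : Matrix n n ℂ} (hV : V ∈ unitaryGroup n ℂ) :
    ∃ W ∈ unitaryGroup n ℂ, ∀ j, (star V * X * V) j j =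
      ((∑ i, Complex.normSq (W j i) * hX.eigenvalues i : ℝ) : ℂ) := by
  refine ⟨star V * hX.eigenvectorUnitary,
    mul_mem (Unitary.star_mem hV) hX.eigenvectorUnitary.2, fun j ↦ ?_⟩
  set W := star V * (hX.eigenvectorUnitary : Matrix n n ℂ) with hW
  have h : star V * X * V = W * diagonal (RCLike.ofReal ∘ hX.eigenvalues) * star W := by
    conv_lhs => rw [hX.spectral_theorem, Unitary.conjStarAlgAut_apply]
    simp only [hW, star_mul, star_star, Matrix.mul_assoc]
  rw [h]
  rw [mul_apply]
  simp only [mul_diagonal, star_apply, Complex.star_def, Function.comp_apply,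
    Complex.ofReal_sum, Complex.ofReal_mul, ← Complex.mul_conj]
  refine Finset.sum_congr rfl fun i _ ↦ ?_
  simp only [Complex.coe_algebraMap]
  ring

theorem re_star_mul_mul_apply_self_mem {X : Matrix n n ℂ} (hX : X.IsHermitian)
    {V : Matrix n n ℂ} (hV : V ∈ unitaryGroup n ℂ) {s : Set ℝ} (hs : Convex ℝ s)
    (hmem : ∀ i, hX.eigenvalues i ∈ s) (j : n) : ((star V * X * V) j j).re ∈ s := by
  obtain ⟨W, hW, h⟩ := hX.exists_unitary_star_mul_mul_apply_self hV
  rw [h, Complex.ofReal_re]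
  exact hs.sum_mem (fun i _ ↦ Complex.normSq_nonneg _) (sum_normSq_row_of_mem_unitaryGroup hW j)
    fun i _ ↦ hmem i

/-- **Peierls inequality**. -/
theorem sum_map_re_star_mul_mul_apply_self_le {X : Matrix n n ℂ} (hX : X.IsHermitian)
    {V : Matrix n n ℂ} (hV : V ∈ unitaryGroup n ℂ) {s : Set ℝ} {f : ℝ → ℝ}
    (hf : ConvexOn ℝ s f) (hmem : ∀ i, hX.eigenvalues i ∈ s) :
    ∑ j, f ((star V * X * V) j j).re ≤ ∑ i, f (hX.eigenvalues i) := by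
  obtain ⟨W, hW, h⟩ := hX.exists_unitary_star_mul_mul_apply_self hV
  calc ∑ j, f ((star V * X * V) j j).re
      ≤ ∑ j, ∑ i, Complex.normSq (W j i) * f (hX.eigenvalues i) := by
        refine Finset.sum_le_sum fun j _ ↦ ?_
        rw [h, Complex.ofReal_re]
        exact hf.map_sum_le (fun i _ ↦ Complex.normSq_nonneg _)
          (sum_normSq_row_of_mem_unitaryGroup hW j) fun i _ ↦ hmem i
    _ = ∑ i, f (hX.eigenvalues i) := by
        rw [Finset.sum_comm]
        simp only [← Finset.sum_mul, sum_normSq_col_of_mem_unitaryGroup hW, one_mul]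

/-- A convex trace function does not increase when a Hermitian matrix is averaged with one of its
unitary conjugates. -/
theorem sum_map_eigenvalues_le_of_add_eq {X P : Matrix n n ℂ} (hX : X.IsHermitian)
    (hP : P.IsHermitian) {Z : Matrix n n ℂ} (hZ : Z ∈ unitaryGroup n ℂ)
    (hXP : X + star Z * X * Z = (2 : ℂ) • P) {s : Set ℝ} {f : ℝ → ℝ} (hf : ConvexOn ℝ s f)
    (hmem : ∀ i, hX.eigenvalues i ∈ s) :
    ∑ j, f (hP.eigenvalues j) ≤ ∑ i, f (hX.eigenvalues i) := by
  let U : Matrix n n ℂ := ↑hP.eigenvectorUnitary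
  have hUmem : U ∈ unitaryGroup n ℂ := hP.eigenvectorUnitary.2
  have hZU : Z * U ∈ unitaryGroup n ℂ := mul_mem hZ hUmem
  have hdiag (j : n) : hP.eigenvalues j =
      2⁻¹ * ((star U * X * U) j j).re + 2⁻¹ * ((star (Z * U) * X * (Z * U)) j j).re := by
    have h₁ : star U * X * U + star (Z * U) * X * (Z * U) = (2 : ℂ) • (star U * P * U) := by
      rw [← Matrix.smul_mul, ← Matrix.mul_smul, ← hXP]
      simp only [star_mul, Matrix.mul_add, Matrix.add_mul, Matrix.mul_assoc]
    have h₂ : star U * P * U = diagonal (RCLike.ofReal ∘ hP.eigenvalues) := by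
      rw [← hP.conjStarAlgAut_star_eigenvectorUnitary, Unitary.conjStarAlgAut_star_apply]
    rw [h₂] at h₁
    have h₃ := congrArg Complex.re (congrFun₂ h₁ j j)
    simp [-star_mul] at h₃
    linarith
  calc ∑ j, f (hP.eigenvalues j)
      ≤ ∑ j, (2⁻¹ * f ((star U * X * U) j j).re +
          2⁻¹ * f ((star (Z * U) * X * (Z * U)) j j).re) := by
        refine Finset.sum_le_sum fun j _ ↦ ?_
        rw [hdiag]
        exact hf.2 (hX.re_star_mul_mul_apply_self_mem hUmem hf.1 hmem j)
          (hX.re_star_mul_mul_apply_self_mem hZU hf.1 hmem j) (by norm_num) (by norm_num)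
          (by norm_num)
    _ ≤ ∑ i, f (hX.eigenvalues i) := by
        rw [Finset.sum_add_distrib, ← Finset.mul_sum, ← Finset.mul_sum]
        linarith [hX.sum_map_re_star_mul_mul_apply_self_le hUmem hf hmem,
          hX.sum_map_re_star_mul_mul_apply_self_le hZU hf hmem]

end IsHermitian

variable {m : Type*} [Fintype m] [DecidableEq m]

theorem fromBlocks_one_neg_one_mem_unitaryGroup :
    fromBlocks (1 : Matrix m m ℂ) 0 0 (-1 : Matrix n n ℂ) ∈ unitaryGroup (m ⊕ n) ℂ := by
  rw [mem_unitaryGroup_iff, star_eq_conjTranspose, fromBlocks_conjTranspose, fromBlocks_multiply]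
  simp

/-- The pinching of a block matrix as an average of unitary conjugates. -/
theorem add_star_mul_mul_eq_two_smul_pinching (X : Matrix (m ⊕ n) (m ⊕ n) ℂ) :
    X + star (fromBlocks (1 : Matrix m m ℂ) 0 0 (-1 : Matrix n n ℂ)) * X *
      fromBlocks (1 : Matrix m m ℂ) 0 0 (-1 : Matrix n n ℂ) =
      (2 : ℂ) • fromBlocks X.toBlocks₁₁ 0 0 X.toBlocks₂₂ := by
  rw [← fromBlocks_toBlocks X, star_eq_conjTranspose, fromBlocks_conjTranspose]
  simp [fromBlocks_multiply, fromBlocks_add, two_smul]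

end Matrix

theorem trEigC_eq_sum_roots_charpoly {ι : Type} [Fintype ι] [DecidableEq ι] (g : ℝ → ℝ)
    {Y : Matrix ι ι ℂ} (hY : Y.IsHermitian) :
    trEigC g Y = (Y.charpoly.roots.map fun z ↦ g z.re).sum := by
  rw [trEigC, dif_pos hY, hY.roots_charpoly_eq_eigenvalues, Multiset.map_map]
  simp

theorem trEigC_fromBlocks_zero {ι κ : Type} [Fintype ι] [DecidableEq ι] [Fintype κ]
    [DecidableEq κ] [DecidableEq (ι ⊕ κ)] (g : ℝ → ℝ) {A : Matrix ι ι ℂ} {B : Matrix κ κ ℂ}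
    (hA : A.IsHermitian) (hB : B.IsHermitian) :
    trEigC g (Matrix.fromBlocks A 0 0 B) = trEigC g A + trEigC g B := by
  have hAB : (Matrix.fromBlocks A 0 0 B).IsHermitian := hA.fromBlocks (by simp) hB
  obtain rfl := Subsingleton.elim ‹DecidableEq (ι ⊕ κ)› instDecidableEqSum
  rw [trEigC_eq_sum_roots_charpoly g hAB, trEigC_eq_sum_roots_charpoly g hA,
    trEigC_eq_sum_roots_charpoly g hB, Matrix.charpoly_fromBlocks_zero₁₂,
    Polynomial.roots_mul (mul_ne_zero A.charpoly_monic.ne_zero B.charpoly_monic.ne_zero),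
    Multiset.map_add, Multiset.sum_add]

/-- **Upper bound to the mutual information** (Lemma 10): for a Hermitian matrix `X` with
spectrum in `[-1,1]` and its pinching `P = X_A ⊕ X_B`, one has
`tr s(P) - tr s(X) ≤ tr u(P) - tr u(X)`, and the upper bound is additive. -/
theorem mutual_information_upper_bound (nA nB : ℕ)
    (X : Matrix (Fin nA ⊕ Fin nB) (Fin nA ⊕ Fin nB) ℂ)
    (hX : X.IsHermitian) (hspec : ∀ i, hX.eigenvalues i ∈ Set.Icc (-1 : ℝ) 1) :
    trEigC sVN (Matrix.fromBlocks X.toBlocks₁₁ 0 0 X.toBlocks₂₂) - trEigC sVN X ≤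
      trEigC uFun (Matrix.fromBlocks X.toBlocks₁₁ 0 0 X.toBlocks₂₂) - trEigC uFun X ∧
    trEigC uFun (Matrix.fromBlocks X.toBlocks₁₁ 0 0 X.toBlocks₂₂) =
      trEigC uFun X.toBlocks₁₁ + trEigC uFun X.toBlocks₂₂ := by
  have hblocks : (Matrix.fromBlocks X.toBlocks₁₁ X.toBlocks₁₂ X.toBlocks₂₁
      X.toBlocks₂₂).IsHermitian := by rwa [Matrix.fromBlocks_toBlocks]
  obtain ⟨hA, -, -, hB⟩ := Matrix.isHermitian_fromBlocks_iff.1 hblocks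
  refine ⟨?_, trEigC_fromBlocks_zero uFun hA hB⟩
  have hP : (Matrix.fromBlocks X.toBlocks₁₁ 0 0 X.toBlocks₂₂).IsHermitian :=
    hA.fromBlocks (by simp) hB
  have h := hX.sum_map_eigenvalues_le_of_add_eq hP
    Matrix.fromBlocks_one_neg_one_mem_unitaryGroup
    (Matrix.add_star_mul_mul_eq_two_smul_pinching X) convexOn_sVN_sub_uFun hspec
  simp only [Finset.sum_sub_distrib] at h
  simp only [trEigC, dif_pos hP, dif_pos hX]
  linarith
end

section
/- Let (t_k)_{k∈ℤ} be complex numbers with t_{−k} = conj(t_k) for all k, and for n ∈ ℕ let T_n be the n×n Hermitian Töplitz matrix with entries (T_n)_{i,j} = t_{i−j}. Let J ⊆ ℝ be an interval containing the spectrum of T_n for every n, let h : J → ℝ be convex, and suppose there exist real constants G and E such that tr h(T_n) − nG − E → 0 as n → ∞ (i.e., the second-order Szegő asymptotics tr h(T_n) = nG + E + o(1) hold). Then E ≤ 0. -/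
open Real Filter
open scoped Classical

/-- The `n × n` Töplitz matrix with entries `(T_n)_{i,j} = t_{i-j}`. -/
def ToeplitzMat (t : ℤ → ℂ) (n : ℕ) : Matrix (Fin n) (Fin n) ℂ :=
  Matrix.of fun i j => t ((i : ℤ) - (j : ℤ))

theorem toeplitzMat_isHermitian {t : ℤ → ℂ} (ht : ∀ k : ℤ, t (-k) = starRingEnd ℂ (t k)) (n : ℕ) :
    (ToeplitzMat t n).IsHermitian := by
  ext i j
  simp [ToeplitzMat, ← ht]

/-- Peierls' inequality: a convex function of the diagonal entries of a unitary conjugate of a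
real diagonal matrix sums to at most its sum over the eigenvalues. -/
theorem sum_convex_diag_le {ι κ : Type*} [Fintype ι] [Fintype κ] [DecidableEq ι] [DecidableEq κ]
    {J : Set ℝ} {h : ℝ → ℝ} (hconv : ConvexOn ℝ J h) {M : Matrix κ ι ℂ}
    (hM : M * M.conjTranspose = 1) (hM' : M.conjTranspose * M = 1) {l : ι → ℝ} {m : κ → ℝ}
    (hl : ∀ i, l i ∈ J)
    (hm : ∀ k, (M * Matrix.diagonal (fun i => (l i : ℂ)) * M.conjTranspose) k k = m k) :
    ∑ k, h (m k) ≤ ∑ i, h (l i) := by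
  have hrow (k : κ) : ∑ i, Complex.normSq (M k i) = 1 := by
    have := congrFun (congrFun hM k) k
    simp only [Matrix.mul_apply, Matrix.conjTranspose_apply, Matrix.one_apply_eq,
      ← starRingEnd_apply, Complex.mul_conj] at this
    exact_mod_cast this
  have hcol (i : ι) : ∑ k, Complex.normSq (M k i) = 1 := by
    have := congrFun (congrFun hM' i) i
    simp only [Matrix.mul_apply, Matrix.conjTranspose_apply, Matrix.one_apply_eq,
      ← starRingEnd_apply, mul_comm _ (M _ _), Complex.mul_conj] at this
    exact_mod_cast this
  have hdiag (k : κ) : m k = ∑ i, Complex.normSq (M k i) * l i := by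
    have := hm k
    simp only [Matrix.mul_apply (N := M.conjTranspose), Matrix.mul_diagonal, Matrix.conjTranspose_apply,
      ← starRingEnd_apply, mul_right_comm (M k _) (l _ : ℂ), Complex.mul_conj] at this
    exact_mod_cast this.symm
  calc ∑ k, h (m k) ≤ ∑ k, ∑ i, Complex.normSq (M k i) * h (l i) := by
        refine Finset.sum_le_sum fun k _ => ?_
        rw [hdiag k]
        simpa only [smul_eq_mul] using hconv.map_sum_le (t := Finset.univ)
          (fun i _ => Complex.normSq_nonneg (M k i)) (hrow k) (fun i _ => hl i)
    _ = ∑ i, h (l i) := by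
        rw [Finset.sum_comm]
        simp only [← Finset.sum_mul, hcol, one_mul]

/-- The trace of a convex function of a Hermitian Töplitz matrix is superadditive under doubling
of the size. -/
theorem two_mul_trEigC_toeplitzMat_le {t : ℤ → ℂ} (ht : ∀ k : ℤ, t (-k) = starRingEnd ℂ (t k))
    {J : Set ℝ} {h : ℝ → ℝ} (hconv : ConvexOn ℝ J h)
    (hspec : ∀ n : ℕ, ∀ hH : (ToeplitzMat t n).IsHermitian, ∀ i, hH.eigenvalues i ∈ J) (n : ℕ) :
    2 * trEigC h (ToeplitzMat t n) ≤ trEigC h (ToeplitzMat t (n + n)) := by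
  have hA := toeplitzMat_isHermitian ht (n + n)
  have hT := toeplitzMat_isHermitian ht n
  rw [trEigC, trEigC, dif_pos hA, dif_pos hT]
  let e : Fin n ⊕ Fin n ≃ Fin (n + n) := finSumFinEquiv
  let A := ToeplitzMat t (n + n)
  let T := ToeplitzMat t n
  let V : Matrix (Fin (n + n)) (Fin (n + n)) ℂ := hA.eigenvectorUnitary
  let U : Matrix (Fin n) (Fin n) ℂ := hT.eigenvectorUnitary
  have hVV : V * V.conjTranspose = 1 := Unitary.coe_mul_star_self hA.eigenvectorUnitary
  have hVV' : V.conjTranspose * V = 1 := Unitary.coe_star_mul_self hA.eigenvectorUnitary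
  have hUU : U * U.conjTranspose = 1 := Unitary.coe_mul_star_self hT.eigenvectorUnitary
  have hUU' : U.conjTranspose * U = 1 := Unitary.coe_star_mul_self hT.eigenvectorUnitary
  have hAV : V * Matrix.diagonal (fun i => (hA.eigenvalues i : ℂ)) * V.conjTranspose = A :=
    hA.spectral_theorem.symm
  have hTU : U * Matrix.diagonal (fun i => (hT.eigenvalues i : ℂ)) * U.conjTranspose = T :=
    hT.spectral_theorem.symm
  have hTU' : U.conjTranspose * T * U = Matrix.diagonal (fun i => (hT.eigenvalues i : ℂ)) := by
    rw [← hTU, Matrix.mul_assoc, Matrix.mul_assoc _ _ U, hUU', ← Matrix.mul_assoc,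
      ← Matrix.mul_assoc, hUU', Matrix.one_mul, Matrix.mul_one]
  have hblocks : A.submatrix e e =
      Matrix.fromBlocks T (A.submatrix e e).toBlocks₁₂ (A.submatrix e e).toBlocks₂₁ T := by
    ext (i | i) (j | j) <;> simp [A, T, e, ToeplitzMat, Matrix.toBlocks₁₂, Matrix.toBlocks₂₁]
  let W : Matrix (Fin n ⊕ Fin n) (Fin n ⊕ Fin n) ℂ := Matrix.fromBlocks U 0 0 U
  have hWW : W * W.conjTranspose = 1 := by
    simp [W, Matrix.fromBlocks_conjTranspose, Matrix.fromBlocks_multiply, hUU]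
  have hWW' : W.conjTranspose * W = 1 := by
    simp [W, Matrix.fromBlocks_conjTranspose, Matrix.fromBlocks_multiply, hUU']
  let S : Matrix (Fin n ⊕ Fin n) (Fin (n + n)) ℂ := V.submatrix e id
  have hSS : S * S.conjTranspose = 1 := by
    rw [Matrix.conjTranspose_submatrix, ← Matrix.submatrix_mul _ _ _ _ _ Function.bijective_id,
      hVV, Matrix.submatrix_one_equiv]
  have hSS' : S.conjTranspose * S = 1 := by
    rw [Matrix.conjTranspose_submatrix, ← Matrix.submatrix_mul _ _ _ _ _ e.bijective,
      hVV', Matrix.submatrix_id_id]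
  have hSA : S * Matrix.diagonal (fun i => (hA.eigenvalues i : ℂ)) * S.conjTranspose =
      A.submatrix e e := by
    rw [← hAV]
    rfl
  let m : Fin n ⊕ Fin n → ℝ := Sum.elim hT.eigenvalues hT.eigenvalues
  have key : ∑ k, h (m k) ≤ ∑ i, h (hA.eigenvalues i) := by
    refine sum_convex_diag_le hconv (M := W.conjTranspose * S) ?_ ?_ (hspec _ hA) fun k => ?_
    · rw [Matrix.conjTranspose_mul, Matrix.conjTranspose_conjTranspose, Matrix.mul_assoc,
        ← Matrix.mul_assoc S, hSS, Matrix.one_mul, hWW']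
    · rw [Matrix.conjTranspose_mul, Matrix.conjTranspose_conjTranspose, Matrix.mul_assoc,
        ← Matrix.mul_assoc W, hWW, Matrix.one_mul, hSS']
    · have : W.conjTranspose * S * Matrix.diagonal (fun i => (hA.eigenvalues i : ℂ)) *
          (W.conjTranspose * S).conjTranspose = W.conjTranspose * A.submatrix e e * W := by
        rw [← hSA, Matrix.conjTranspose_mul, Matrix.conjTranspose_conjTranspose]
        simp only [Matrix.mul_assoc]
      rw [this, hblocks]
      rcases k with k | k <;>
        simp [W, m, Matrix.fromBlocks_conjTranspose, Matrix.fromBlocks_multiply, hTU']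
  simpa [m, two_mul] using key

/-- **Nonpositivity of the second-order term for convex functions of Hermitian Töplitz
matrices** (Theorem 8): if `tr h(T_n) = nG + E + o(1)` with `h` convex on an interval
containing all spectra, then `E ≤ 0`. -/
theorem second_order_term_nonpos_of_convex
    (t : ℤ → ℂ) (ht : ∀ k : ℤ, t (-k) = starRingEnd ℂ (t k))
    (J : Set ℝ) (hJ : Convex ℝ J) (h : ℝ → ℝ) (hconv : ConvexOn ℝ J h)
    (hspec : ∀ n : ℕ, ∀ hH : (ToeplitzMat t n).IsHermitian, ∀ i, hH.eigenvalues i ∈ J)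
    (G E : ℝ)
    (hasymp : Tendsto (fun n : ℕ => trEigC h (ToeplitzMat t n) - n * G - E) atTop
      (nhds 0)) :
    E ≤ 0 := by
  have hdouble : Tendsto (fun n : ℕ => n + n) atTop atTop :=
    tendsto_atTop_mono (fun n => Nat.le_add_left n n) tendsto_id
  have hlim := (hasymp.comp hdouble).sub (hasymp.const_mul 2)
  have hle : ∀ n : ℕ, E ≤ ((fun n : ℕ => trEigC h (ToeplitzMat t n) - n * G - E) ∘
      fun n : ℕ => n + n) n - 2 * (trEigC h (ToeplitzMat t n) - n * G - E) := fun n => by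
    have := two_mul_trEigC_toeplitzMat_le ht hconv hspec n
    simp only [Function.comp_apply]
    push_cast
    linarith
  simpa using ge_of_tendsto' hlim hle
end

section
/- Let a₁ < a₂ and b₁ < b₂ be real numbers. Then ∫_{a₁}^{a₂} ∫_{b₁}^{b₂} (e^{−x} − e^{−y})/(y − x) dy dx = F(b₁,a₁,a₂) + F(a₁,b₁,b₂) − F(b₂,a₁,a₂) − F(a₂,b₁,b₂), where F(a,b,c) := e^{−a}(F̃(b − a) − F̃(c − a)) and F̃(x) := γ_E + Σ_{k=1}^{∞} (−1)^k x^k/(k·k!), with γ_E the Euler–Mascheroni constant; the integrand (e^{−x} − e^{−y})/(y − x) is extended by its limiting value e^{−x} at y = x. -/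
open Real

/-- The entire function `F̃(x) = γ_E + ∑_{k≥1} (-1)^k x^k/(k·k!)`, equal to
`Ei(-x) - log|x|` for `x ≠ 0`. -/
noncomputable def Ftilde (x : ℝ) : ℝ :=
  Real.eulerMascheroniConstant +
    ∑' k : ℕ, (-1 : ℝ) ^ (k + 1) * x ^ (k + 1) / ((k + 1) * Nat.factorial (k + 1))

/-- The auxiliary function `F(a,b,c) = e^{-a}(F̃(b-a) - F̃(c-a))`. -/
noncomputable def Fexp (a b c : ℝ) : ℝ := Real.exp (-a) * (Ftilde (b - a) - Ftilde (c - a))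

open intervalIntegral

/-- The function `u ↦ (1 - e^{-u})/u`, extended continuously to `u = 0`. -/
noncomputable def expQuotient (u : ℝ) : ℝ := dslope (fun t : ℝ => -Real.exp (-t)) 0 u

lemma hasDerivAt_neg_exp_neg (u : ℝ) :
    HasDerivAt (fun t : ℝ => -Real.exp (-t)) (Real.exp (-u)) u := by
  exact ((hasDerivAt_neg u).exp).neg.congr_deriv (by ring)

lemma expQuotient_zero : expQuotient 0 = 1 := by
  simp [expQuotient, dslope_same, (hasDerivAt_neg_exp_neg 0).deriv]

lemma expQuotient_of_ne {u : ℝ} (hu : u ≠ 0) : expQuotient u = (1 - Real.exp (-u)) / u := by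
  rw [expQuotient, dslope_of_ne _ hu, slope_def_field]
  simp only [neg_zero, Real.exp_zero, sub_zero]
  ring

lemma continuous_expQuotient : Continuous expQuotient := by
  rw [continuous_iff_continuousAt]
  intro u
  rcases eq_or_ne u 0 with rfl | hu
  · exact continuousAt_dslope_same.2 (hasDerivAt_neg_exp_neg 0).differentiableAt
  · exact (continuousAt_dslope_of_ne hu).2 (hasDerivAt_neg_exp_neg u).continuousAt

lemma exp_difference_quotient_eq (x y : ℝ) :
    (if y = x then Real.exp (-x) else (Real.exp (-x) - Real.exp (-y)) / (y - x)) =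
      Real.exp (-x) * expQuotient (y - x) := by
  split_ifs with h
  · simp [h, expQuotient_zero]
  · rw [expQuotient_of_ne (sub_ne_zero.2 h), ← mul_div_assoc, mul_sub, ← Real.exp_add]
    ring_nf

lemma exp_mul_expQuotient_symm (x b : ℝ) :
    Real.exp (-x) * expQuotient (b - x) = Real.exp (-b) * expQuotient (x - b) := by
  rw [← exp_difference_quotient_eq, ← exp_difference_quotient_eq]
  rcases eq_or_ne b x with rfl | h
  · rfl
  · rw [if_neg h, if_neg h.symm, ← neg_sub x b, div_neg, ← neg_div, neg_sub]

lemma tsum_neg_one_pow_mul_pow_div_factorial_succ (x : ℝ) :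
    ∑' k : ℕ, (-1 : ℝ) ^ (k + 1) * x ^ k / Nat.factorial (k + 1) = -expQuotient x := by
  rcases eq_or_ne x 0 with rfl | hx
  · rw [tsum_eq_single 0 (fun k hk => by simp [hk]), expQuotient_zero]
    simp
  · have h : HasSum (fun k : ℕ => (-x) ^ k / Nat.factorial k) (Real.exp (-x)) := by
      rw [Real.exp_eq_exp_ℝ]
      exact NormedSpace.expSeries_div_hasSum_exp (-x)
    have h₁ := (((hasSum_nat_add_iff' 1).2 h).div_const x).tsum_eq
    have hterm (k : ℕ) : (-1 : ℝ) ^ (k + 1) * x ^ k / Nat.factorial (k + 1) =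
        (-x) ^ (k + 1) / Nat.factorial (k + 1) / x := by
      rw [neg_pow x]
      field_simp
      ring
    rw [tsum_congr hterm, h₁, expQuotient_of_ne hx, ← neg_div]
    simp

lemma hasDerivAt_Ftilde (x : ℝ) : HasDerivAt Ftilde (-expQuotient x) x := by
  have hR : 0 < |x| + 1 := by positivity
  have h0 : (0 : ℝ) ∈ Metric.ball (0 : ℝ) (|x| + 1) := by simpa using hR
  have hx : x ∈ Metric.ball (0 : ℝ) (|x| + 1) := by simp
  rw [← tsum_neg_one_pow_mul_pow_div_factorial_succ]
  refine HasDerivAt.const_add _ (hasDerivAt_tsum_of_isPreconnected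
    (u := fun k : ℕ => (|x| + 1) ^ k / Nat.factorial k)
    (g := fun k y => (-1 : ℝ) ^ (k + 1) * y ^ (k + 1) / ((k + 1) * Nat.factorial (k + 1)))
    (g' := fun k y => (-1 : ℝ) ^ (k + 1) * y ^ k / Nat.factorial (k + 1))
    (Real.summable_pow_div_factorial _)
    Metric.isOpen_ball (convex_ball _ _).isPreconnected ?_ ?_ h0 ?_ hx)
  · intro k y _
    refine (((hasDerivAt_pow (k + 1) y).const_mul ((-1 : ℝ) ^ (k + 1))).div_const
      ((k + 1) * Nat.factorial (k + 1) : ℝ)).congr_deriv ?_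
    push_cast
    field_simp
  · intro k y hy
    have hy' : |y| ≤ |x| + 1 := by simpa using (Metric.mem_ball.1 hy).le
    simp only [norm_div, norm_mul, norm_pow, norm_neg, norm_one, one_pow, one_mul,
      Real.norm_eq_abs, Nat.abs_cast]
    gcongr
    exact Nat.le_succ k
  · simp

lemma integral_exp_difference_quotient (x b₁ b₂ : ℝ) :
    (∫ y in b₁..b₂,
        (if y = x then Real.exp (-x) else (Real.exp (-x) - Real.exp (-y)) / (y - x))) =
      Real.exp (-x) * Ftilde (b₁ - x) - Real.exp (-x) * Ftilde (b₂ - x) := by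
  simp_rw [exp_difference_quotient_eq]
  rw [integral_eq_sub_of_hasDerivAt (f := fun y => -(Real.exp (-x) * Ftilde (y - x)))]
  · ring
  · intro y _
    exact (((hasDerivAt_Ftilde (y - x)).comp_sub_const y x).const_mul
      (Real.exp (-x))).neg.congr_deriv (by ring)
  · exact (continuous_const.mul
      (continuous_expQuotient.comp (continuous_id.sub continuous_const))).intervalIntegrable _ _

lemma continuous_exp_neg_mul_Ftilde (b : ℝ) :
    Continuous fun x => Real.exp (-x) * Ftilde (b - x) := by
  have h : Continuous Ftilde :=
    continuous_iff_continuousAt.2 fun x => (hasDerivAt_Ftilde x).continuousAt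
  fun_prop

lemma integral_exp_neg_mul_Ftilde (b a₁ a₂ : ℝ) :
    ∫ x in a₁..a₂, Real.exp (-x) * Ftilde (b - x) =
      Real.exp (-a₁) * Ftilde (b - a₁) + Real.exp (-b) * Ftilde (a₁ - b) -
        (Real.exp (-a₂) * Ftilde (b - a₂) + Real.exp (-b) * Ftilde (a₂ - b)) := by
  rw [integral_eq_sub_of_hasDerivAt (f := fun x =>
    -Real.exp (-x) * Ftilde (b - x) - Real.exp (-b) * Ftilde (x - b))]
  · ring
  · intro x _
    refine HasDerivAt.congr_deriv (((hasDerivAt_neg_exp_neg x).mul ((hasDerivAt_Ftilde (b - x)).comp_const_sub b x)).sub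
      (((hasDerivAt_Ftilde (x - b)).comp_sub_const x b).const_mul (Real.exp (-b)))) ?_
    linear_combination -exp_mul_expQuotient_symm x b
  · exact (continuous_exp_neg_mul_Ftilde b).intervalIntegrable _ _

/-- **Integral over the exponential difference quotient** (Lemma 12): the double integral
of `(e^{-x} - e^{-y})/(y - x)` (with its removable singularity on the diagonal filled in by
`e^{-x}`) over `[a₁,a₂] × [b₁,b₂]` equals
`F(b₁,a₁,a₂) + F(a₁,b₁,b₂) - F(b₂,a₁,a₂) - F(a₂,b₁,b₂)`. -/
theorem exponential_difference_quotient_integral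
    (a₁ a₂ b₁ b₂ : ℝ) (ha : a₁ < a₂) (hb : b₁ < b₂) :
    (∫ x in a₁..a₂, ∫ y in b₁..b₂,
        (if y = x then Real.exp (-x) else (Real.exp (-x) - Real.exp (-y)) / (y - x))) =
      Fexp b₁ a₁ a₂ + Fexp a₁ b₁ b₂ - Fexp b₂ a₁ a₂ - Fexp a₂ b₁ b₂ := by
  simp_rw [integral_exp_difference_quotient]
  rw [integral_sub ((continuous_exp_neg_mul_Ftilde b₁).intervalIntegrable _ _)
    ((continuous_exp_neg_mul_Ftilde b₂).intervalIntegrable _ _),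
    integral_exp_neg_mul_Ftilde, integral_exp_neg_mul_Ftilde]
  simp only [Fexp]
  ring
end
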